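/- arXiv:0710.3656 — 7 statements merged into one kernel-verified Lean document; each statement's English description precedes it below -/
import Mathlib

section
/- For every point x ∈ ℝ^d with x_k ≠ 0 for all k, there exist exactly d real numbers λ₁ < λ₂ < … < λ_d such that x ∈ Q_{λ_i} for each i, and these interlace the a's strictly: λ₁ < a₁ < λ₂ < a₂ < … < λ_d < a_d. Moreover, the quadrics Q_{λ_i} intersect orthogonally at x: for all i ≠ j one has Σ_{k=1}^d x_k²/((a_k−λ_i)(a_k−λ_j)) = 0, i.e. the gradients at x of the defining functions of Q_{λ_i} and Q_{λ_j} are orthogonal. -/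
noncomputable section

open scoped BigOperators

/-- The bilinear form `Q_λ(u,v) = Σ_k u_k v_k / (a_k - λ)` of the confocal family. -/
def Qf {d : ℕ} (a : Fin d → ℝ) (lam : ℝ) (u v : Fin d → ℝ) : ℝ :=
  ∑ k, u k * v k / (a k - lam)

/-- Tangency discriminant `Φ_λ(x,y) = Q_λ(x,y)² − Q_λ(y)(Q_λ(x) − 1)`. -/
def Phi {d : ℕ} (a : Fin d → ℝ) (lam : ℝ) (x y : Fin d → ℝ) : ℝ :=
  (Qf a lam x y) ^ 2 - (Qf a lam y y) * (Qf a lam x x - 1)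

/-- The line `{x + t y : t ∈ ℝ}`. -/
def lineSet {d : ℕ} (x y : Fin d → ℝ) : Set (Fin d → ℝ) :=
  {p | ∃ t : ℝ, p = x + t • y}

/-- A line is tangent to the quadric `Q_λ` if `Φ_λ(x,y) = 0` for some (hence any)
parametrization. -/
def IsTangent {d : ℕ} (a : Fin d → ℝ) (lam : ℝ) (ℓ : Set (Fin d → ℝ)) : Prop :=
  ∃ x y : Fin d → ℝ, y ≠ 0 ∧ ℓ = lineSet x y ∧ Phi a lam x y = 0

/-- The normal vector `N_λ(P) = (P_k/(a_k − λ))_k` of `Q_λ` at `P`. -/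
def confNormal {d : ℕ} (a : Fin d → ℝ) (lam : ℝ) (P : Fin d → ℝ) : Fin d → ℝ :=
  fun k => P k / (a k - lam)

/-- Euclidean dot product on `ℝ^d`. -/
def dotp {d : ℕ} (u v : Fin d → ℝ) : ℝ := ∑ k, u k * v k

/-- Orthogonal reflection of the vector `v` in the hyperplane orthogonal to `n`. -/
def reflVec {d : ℕ} (n v : Fin d → ℝ) : Fin d → ℝ :=
  v - (2 * dotp v n / dotp n n) • n

/-- Lines `ℓ₁, ℓ₂` satisfy the billiard reflection law at the point `P` of the quadric `Q_λ`:
they are distinct, both pass through `P ∈ Q_λ`, and the orthogonal reflection in the hyperplane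
orthogonal to `N_λ(P)` maps a direction vector of `ℓ₁` to a vector parallel to a direction
vector of `ℓ₂`. -/
def ReflLaw {d : ℕ} (a : Fin d → ℝ) (lam : ℝ) (P : Fin d → ℝ)
    (ℓ₁ ℓ₂ : Set (Fin d → ℝ)) : Prop :=
  ℓ₁ ≠ ℓ₂ ∧ P ∈ ℓ₁ ∧ P ∈ ℓ₂ ∧ Qf a lam P P = 1 ∧
    ∃ v₁ v₂ : Fin d → ℝ, v₁ ≠ 0 ∧ v₂ ≠ 0 ∧ (∃ x₁, ℓ₁ = lineSet x₁ v₁) ∧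
      (∃ x₂, ℓ₂ = lineSet x₂ v₂) ∧
      ∃ c : ℝ, c ≠ 0 ∧ reflVec (confNormal a lam P) v₁ = c • v₂

theorem Qf_sub {d : ℕ} (a x : Fin d → ℝ) (s t : ℝ) (hs : ∀ k, a k - s ≠ 0)
    (ht : ∀ k, a k - t ≠ 0) :
    Qf a s x x - Qf a t x x = (s - t) * ∑ k, x k ^ 2 / ((a k - s) * (a k - t)) := by
  unfold Qf
  rw [← Finset.sum_sub_distrib, Finset.mul_sum]
  refine Finset.sum_congr rfl fun k _ => ?_
  have h1 := hs k
  have h2 := ht k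
  field_simp
  ring

theorem Qf_split {d : ℕ} (a x : Fin d → ℝ) (i : Fin d) (t : ℝ) :
    Qf a t x x = (∑ k ∈ Finset.univ.erase i, x k * x k / (a k - t)) + x i * x i * (a i - t)⁻¹ := by
  unfold Qf
  rw [← div_eq_mul_inv]
  exact (Finset.sum_erase_add _ _ (Finset.mem_univ i)).symm

theorem rest_cont {d : ℕ} (a : Fin d → ℝ) (ha : StrictMono a) (x : Fin d → ℝ) (i : Fin d) :
    ContinuousAt (fun t => ∑ k ∈ Finset.univ.erase i, x k * x k / (a k - t)) (a i) := by
  refine tendsto_finsetSum _ fun k hk => ?_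
  have hne : a k - a i ≠ 0 := sub_ne_zero.2 (ha.injective.ne (Finset.ne_of_mem_erase hk))
  exact ContinuousAt.div continuousAt_const (by fun_prop) hne

theorem exists_left {d : ℕ} (a : Fin d → ℝ) (ha : StrictMono a) (x : Fin d → ℝ)
    (hx : ∀ k, x k ≠ 0) (i : Fin d) (m : ℝ) (hm : m < a i) :
    ∃ t, m < t ∧ t < a i ∧ 1 < Qf a t x x := by
  have h1 : Filter.Tendsto (fun t => a i - t) (nhdsWithin (a i) (Set.Iio (a i)))
      (nhdsWithin 0 (Set.Ioi 0)) := by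
    refine tendsto_nhdsWithin_iff.2 ⟨?_, ?_⟩
    · have : ContinuousAt (fun t => a i - t) (a i) := by fun_prop
      simpa [ContinuousAt] using this.tendsto.mono_left nhdsWithin_le_nhds
    · filter_upwards [self_mem_nhdsWithin] with t ht
      exact Set.mem_Ioi.2 (sub_pos.2 (Set.mem_Iio.1 ht))
  have h2 := (tendsto_inv_nhdsGT_zero.comp h1).const_mul_atTop (mul_self_pos.2 (hx i))
  have h3 := ((rest_cont a ha x i).tendsto.mono_left
    (nhdsWithin_le_nhds (s := Set.Iio (a i)))).add_atTop h2
  obtain ⟨t, ht, ht1, ht2⟩ := ((h3.eventually_gt_atTop 1).and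
    ((Ioo_mem_nhdsLT hm))).exists
  refine ⟨t, ht1, ht2, ?_⟩
  rw [Qf_split a x i]
  exact ht

theorem exists_right {d : ℕ} (a : Fin d → ℝ) (ha : StrictMono a) (x : Fin d → ℝ)
    (hx : ∀ k, x k ≠ 0) (i : Fin d) (m : ℝ) (hm : a i < m) :
    ∃ t, a i < t ∧ t < m ∧ Qf a t x x < 1 := by
  have h1 : Filter.Tendsto (fun t => a i - t) (nhdsWithin (a i) (Set.Ioi (a i)))
      (nhdsWithin 0 (Set.Iio 0)) := by
    refine tendsto_nhdsWithin_iff.2 ⟨?_, ?_⟩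
    · have : ContinuousAt (fun t => a i - t) (a i) := by fun_prop
      simpa [ContinuousAt] using this.tendsto.mono_left nhdsWithin_le_nhds
    · filter_upwards [self_mem_nhdsWithin] with t ht
      exact Set.mem_Iio.2 (sub_neg.2 (Set.mem_Ioi.1 ht))
  have h2 := (tendsto_inv_nhdsLT_zero.comp h1).const_mul_atBot (mul_self_pos.2 (hx i))
  have h3 := ((rest_cont a ha x i).tendsto.mono_left
    (nhdsWithin_le_nhds (s := Set.Ioi (a i)))).add_atBot h2
  obtain ⟨t, ht, ht1, ht2⟩ := ((h3.eventually_lt_atBot 1).and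
    ((Ioo_mem_nhdsGT hm))).exists
  refine ⟨t, ht1, ht2, ?_⟩
  rw [Qf_split a x i]
  exact ht

theorem exists_far {d : ℕ} (a x : Fin d → ℝ) (m : ℝ) :
    ∃ t, t < m ∧ Qf a t x x < 1 := by
  have h : Filter.Tendsto (fun t => Qf a t x x) Filter.atBot (nhds (∑ _k : Fin d, 0)) := by
    unfold Qf
    refine tendsto_finsetSum _ fun k _ => ?_
    refine Filter.Tendsto.const_div_atTop ?_ _
    exact Filter.tendsto_atTop_add_const_left _ _ Filter.tendsto_neg_atBot_atTop
  rw [Finset.sum_const_zero] at h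
  obtain ⟨t, h1, h2⟩ := ((h.eventually (gt_mem_nhds one_pos)).and
    (Filter.eventually_lt_atBot m)).exists
  exact ⟨t, h2, h1⟩

theorem exists_root {d : ℕ} (a : Fin d → ℝ) (ha : StrictMono a) (x : Fin d → ℝ)
    (hx : ∀ k, x k ≠ 0) (i : Fin d) :
    ∃ t, t < a i ∧ (∀ j < i, a j < t) ∧ Qf a t x x = 1 := by
  obtain ⟨l, hl, hlj, hF⟩ : ∃ l, l < a i ∧ (∀ j < i, a j < l) ∧ Qf a l x x < 1 := by
    rcases Nat.eq_zero_or_pos (i : ℕ) with h0 | h0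
    · obtain ⟨t, h1, h2⟩ := exists_far a x (a i)
      refine ⟨t, h1, fun j hj => ?_, h2⟩
      have := Fin.lt_def.1 hj
      omega
    · have hi := i.2
      let p : Fin d := ⟨(i : ℕ) - 1, by omega⟩
      have hp : p < i := Fin.lt_def.2 (by simp only [p]; omega)
      obtain ⟨t, h1, h2, h3⟩ := exists_right a ha x hx p (a i) (ha hp)
      refine ⟨t, h2, fun j hj => lt_of_le_of_lt (ha.monotone ?_) h1, h3⟩
      have := Fin.lt_def.1 hj
      exact Fin.le_def.2 (by simp only [p]; omega)
  obtain ⟨u, hu, hui, hFu⟩ := exists_left a ha x hx i l hl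
  have hc : ContinuousOn (fun t => Qf a t x x) (Set.Icc l u) := by
    unfold Qf
    refine continuousOn_finsetSum _ fun k _ => ?_
    refine ContinuousOn.div continuousOn_const (by fun_prop) fun t ht => ?_
    rcases lt_or_ge k i with h | h
    · have := hlj k h
      have := ht.1
      exact ne_of_lt (by linarith)
    · have := ha.monotone h
      have := ht.2
      exact ne_of_gt (by linarith)
  obtain ⟨t, ht, hQ⟩ := intermediate_value_Icc hu.le hc ⟨hF.le, hFu.le⟩
  exact ⟨t, lt_of_le_of_lt ht.2 hui, fun j hj => lt_of_lt_of_le (hlj j hj) ht.1, hQ⟩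

/-- Jacobi: every point of `ℝ^d` with all coordinates nonzero lies on exactly
`d` quadrics of the confocal family, with parameters strictly interlacing the `a`'s, and these
quadrics intersect orthogonally at the point. -/
theorem jacobi_coordinates_and_orthogonality {d : ℕ} (hd : 2 ≤ d)
    (a : Fin d → ℝ) (ha : StrictMono a)
    (x : Fin d → ℝ) (hx : ∀ k, x k ≠ 0) :
    ∃ lam : Fin d → ℝ, StrictMono lam ∧
      (∀ i, lam i < a i) ∧
      (∀ (i : Fin d) (h : (i : ℕ) + 1 < d), a i < lam ⟨(i : ℕ) + 1, h⟩) ∧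
      (∀ i, Qf a (lam i) x x = 1) ∧
      (∀ μ : ℝ, (∀ k, μ ≠ a k) → Qf a μ x x = 1 → ∃ i, μ = lam i) ∧
      (∀ i j, i ≠ j → ∑ k, x k ^ 2 / ((a k - lam i) * (a k - lam j)) = 0) := by
  choose lam h1 h2 h3 using exists_root a ha x hx
  have hmono : StrictMono lam := fun i j hij => (h1 i).trans (h2 j i hij)
  have hne : ∀ i k, a k - lam i ≠ 0 := by
    intro i k
    rcases lt_or_ge k i with h | h
    · exact ne_of_lt (sub_neg.2 (h2 i k h))
    · exact ne_of_gt (sub_pos.2 ((h1 i).trans_le (ha.monotone h)))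
  refine ⟨lam, hmono, h1, fun i h => h2 _ _ (Fin.lt_def.2 (by simp)), h3, ?_, ?_⟩
  · intro μ hμ hQ
    have hex : ∃ i, μ < a i := by
      by_contra! hcon
      have : Qf a μ x x ≤ 0 := Finset.sum_nonpos fun k _ =>
        div_nonpos_of_nonneg_of_nonpos (mul_self_nonneg _) (sub_nonpos.2 (hcon k))
      linarith
    obtain ⟨i, hi, hmin⟩ : ∃ i, μ < a i ∧ ∀ j < i, a j < μ := by
      obtain ⟨i, hi, hm⟩ := WellFounded.has_min (wellFounded_lt (α := Fin d))
        {i | μ < a i} hex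
      exact ⟨i, hi, fun j hj => lt_of_le_of_ne (not_lt.1 fun h => hm j h hj) (hμ j).symm⟩
    refine ⟨i, ?_⟩
    have key := Qf_sub a x μ (lam i) (fun k => sub_ne_zero.2 (hμ k).symm) (hne i)
    rw [hQ, h3, sub_self] at key
    have hpos : 0 < ∑ k, x k ^ 2 / ((a k - μ) * (a k - lam i)) := by
      refine Finset.sum_pos (fun k _ => div_pos (sq_pos_iff.2 (hx k)) ?_) ⟨i, Finset.mem_univ i⟩
      rcases lt_or_ge k i with h | h
      · exact mul_pos_of_neg_of_neg (sub_neg.2 (hmin k h)) (sub_neg.2 (h2 i k h))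
      · exact mul_pos (sub_pos.2 (hi.trans_le (ha.monotone h)))
          (sub_pos.2 ((h1 i).trans_le (ha.monotone h)))
    rcases mul_eq_zero.1 key.symm with h | h
    · exact sub_eq_zero.1 h
    · exact absurd h hpos.ne'
  · intro i j hij
    have key := Qf_sub a x (lam i) (lam j) (hne i) (hne j)
    rw [h3, h3, sub_self] at key
    exact (mul_eq_zero.1 key.symm).resolve_left (sub_ne_zero.2 (hmono.injective.ne hij))
end
end

section
/- For every x ∈ ℝ^d and every y ∈ ℝ^d ∖ {0}, the function λ ↦ Φ_λ(x,y)·∏_{k=1}^d (a_k−λ), defined for λ ∈ ℝ ∖ {a₁,…,a_d}, extends to a polynomial in λ of degree exactly d−1 with leading coefficient (−1)^{d+1}‖y‖². Consequently, every line in ℝ^d is tangent to at most d−1 quadrics Q_λ of the confocal family. -/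
noncomputable section

open scoped BigOperators

open Polynomial in
lemma natDegree_prodS {d : ℕ} (a : Fin d → ℝ) (S : Finset (Fin d)) :
    (∏ i ∈ S, (C (a i) - X : ℝ[X])).natDegree ≤ S.card := by
  refine (natDegree_prod_le _ _).trans ?_
  refine (Finset.sum_le_card_nsmul S _ 1 ?_).trans (by simp)
  intro i _
  compute_degree

open Polynomial in
lemma coeff_prodS {d : ℕ} (a : Fin d → ℝ) (S : Finset (Fin d)) :
    (∏ i ∈ S, (C (a i) - X : ℝ[X])).coeff S.card = (-1) ^ S.card := by
  have h := coeff_prod_of_natDegree_le (s := S) (fun i => (C (a i) - X : ℝ[X])) 1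
    (fun i _ => by compute_degree)
  simpa [coeff_C] using h

open Polynomial in
/-- The tangency polynomial. -/
def tangPoly {d : ℕ} (a x y : Fin d → ℝ) : ℝ[X] :=
  (∑ k, C (y k ^ 2) * ∏ i ∈ Finset.univ.erase k, (C (a i) - X)) -
    ∑ k, ∑ j, C ((x j * y k - x k * y j) ^ 2 / 2) *
      ∏ i ∈ (Finset.univ.erase k).erase j, (C (a i) - X)

lemma phi_expand {d : ℕ} (a x y : Fin d → ℝ) (lam : ℝ) :
    Phi a lam x y = (∑ k, y k ^ 2 / (a k - lam)) -
      ∑ k, ∑ j, (x j * y k - x k * y j) ^ 2 / 2 / ((a k - lam) * (a j - lam)) := by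
  have h1 : Phi a lam x y = Qf a lam y y + (Qf a lam x y * Qf a lam x y -
      (Qf a lam y y * Qf a lam x x + Qf a lam x x * Qf a lam y y) / 2) := by
    unfold Phi; ring
  rw [h1, sub_eq_add_neg (∑ k, y k ^ 2 / (a k - lam))]
  congr 1
  · unfold Qf
    exact Finset.sum_congr rfl fun k _ => by ring
  · unfold Qf
    simp only [Finset.sum_mul_sum]
    rw [← Finset.sum_add_distrib, Finset.sum_div, ← Finset.sum_sub_distrib,
      ← Finset.sum_neg_distrib]
    refine Finset.sum_congr rfl fun k _ => ?_
    rw [← Finset.sum_add_distrib, Finset.sum_div, ← Finset.sum_sub_distrib,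
      ← Finset.sum_neg_distrib]
    refine Finset.sum_congr rfl fun j _ => ?_
    simp only [div_eq_mul_inv, mul_inv]
    ring

lemma tangPoly_eval {d : ℕ} (a x y : Fin d → ℝ) (lam : ℝ) (h : ∀ k, lam ≠ a k) :
    (tangPoly a x y).eval lam = Phi a lam x y * ∏ k, (a k - lam) := by
  have hne : ∀ k, a k - lam ≠ 0 := fun k => sub_ne_zero.mpr (h k).symm
  rw [phi_expand]
  simp only [tangPoly, Polynomial.eval_sub, Polynomial.eval_finsetSum, Polynomial.eval_mul,
    Polynomial.eval_C, Polynomial.eval_prod, Polynomial.eval_X, sub_mul _ _ (∏ k, (a k - lam)),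
    Finset.sum_mul]
  congr 1
  · refine Finset.sum_congr rfl fun k _ => ?_
    rw [← Finset.mul_prod_erase _ _ (Finset.mem_univ k)]
    have := hne k
    field_simp
  · refine Finset.sum_congr rfl fun k _ => Finset.sum_congr rfl fun j _ => ?_
    by_cases hjk : j = k
    · subst hjk; simp
    rw [← Finset.mul_prod_erase _ _ (Finset.mem_univ k),
      ← Finset.mul_prod_erase (Finset.univ.erase k) _
        (Finset.mem_erase.mpr ⟨hjk, Finset.mem_univ j⟩)]
    have := hne k
    have := hne j
    field_simp

lemma card_erase_one {d : ℕ} (k : Fin d) : (Finset.univ.erase k).card = d - 1 := by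
  simp [Finset.card_erase_of_mem]

lemma tangPoly_natDegree {d : ℕ} (a x y : Fin d → ℝ) :
    (tangPoly a x y).natDegree ≤ d - 1 := by
  refine (Polynomial.natDegree_sub_le_of_le (m := d - 1) (n := d - 1) ?_ ?_).trans (by simp)
  · refine Polynomial.natDegree_sum_le_of_forall_le _ _ fun k _ => ?_
    refine (Polynomial.natDegree_C_mul_le _ _).trans ((natDegree_prodS _ _).trans ?_)
    rw [card_erase_one]
  · refine Polynomial.natDegree_sum_le_of_forall_le _ _ fun k _ =>
      Polynomial.natDegree_sum_le_of_forall_le _ _ fun j _ => ?_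
    refine (Polynomial.natDegree_C_mul_le _ _).trans ((natDegree_prodS _ _).trans ?_)
    rw [← card_erase_one k]
    exact Finset.card_erase_le

lemma tangPoly_coeff {d : ℕ} (hd : 2 ≤ d) (a x y : Fin d → ℝ) :
    (tangPoly a x y).coeff (d - 1) = (-1 : ℝ) ^ (d + 1) * ∑ k, y k ^ 2 := by
  have hs : (-1 : ℝ) ^ (d + 1) = (-1) ^ (d - 1) := by
    obtain ⟨e, rfl⟩ := Nat.exists_eq_add_of_le' hd
    simp [pow_succ]
  simp only [tangPoly, Polynomial.coeff_sub, Polynomial.finsetSum_coeff,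
    Polynomial.coeff_C_mul]
  rw [hs, Finset.mul_sum, sub_eq_iff_eq_add, Finset.sum_eq_zero (f := fun k => ∑ j, _), add_zero]
  · refine Finset.sum_congr rfl fun k _ => ?_
    have := coeff_prodS a (Finset.univ.erase k)
    rw [card_erase_one] at this
    rw [this, mul_comm]
  · intro k _
    refine Finset.sum_eq_zero fun j _ => ?_
    by_cases hjk : j = k
    · subst hjk; simp
    rw [Polynomial.coeff_eq_zero_of_natDegree_lt, mul_zero]
    refine (natDegree_prodS _ _).trans_lt ?_
    rw [← card_erase_one k]
    exact Finset.card_erase_lt_of_mem (Finset.mem_erase.mpr ⟨hjk, Finset.mem_univ j⟩)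

/-- `λ ↦ Φ_λ(x,y)·∏(a_k−λ)` extends to a polynomial of degree exactly `d−1`
with leading coefficient `(−1)^{d+1}‖y‖²`; consequently a line is tangent to at most `d−1`
quadrics of the confocal family. -/
theorem tangency_polynomial_and_chasles {d : ℕ} (hd : 2 ≤ d)
    (a : Fin d → ℝ) (ha : StrictMono a)
    (x y : Fin d → ℝ) (hy : y ≠ 0) :
    (∃ p : Polynomial ℝ,
      p.degree = (d - 1 : ℕ) ∧
      p.leadingCoeff = (-1 : ℝ) ^ (d + 1) * ∑ k, y k ^ 2 ∧
      ∀ lam : ℝ, (∀ k, lam ≠ a k) →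
        p.eval lam = Phi a lam x y * ∏ k, (a k - lam)) ∧
    {lam : ℝ | (∀ k, lam ≠ a k) ∧ Phi a lam x y = 0}.Finite ∧
    {lam : ℝ | (∀ k, lam ≠ a k) ∧ Phi a lam x y = 0}.ncard ≤ d - 1 := by
  have hpos : 0 < ∑ k, y k ^ 2 := by
    obtain ⟨k, hk⟩ := Function.ne_iff.mp hy
    have hk' : y k ≠ 0 := hk
    exact Finset.sum_pos' (fun i _ => sq_nonneg _) ⟨k, Finset.mem_univ k, by positivity⟩
  have hc := tangPoly_coeff hd a x y
  have hcne : (tangPoly a x y).coeff (d - 1) ≠ 0 := by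
    rw [hc]
    exact mul_ne_zero (pow_ne_zero _ (by norm_num)) hpos.ne'
  have hnd : (tangPoly a x y).natDegree = d - 1 :=
    le_antisymm (tangPoly_natDegree a x y) (Polynomial.le_natDegree_of_ne_zero hcne)
  have hp0 : tangPoly a x y ≠ 0 := fun h => hcne (by rw [h]; simp)
  have hsub : {lam : ℝ | (∀ k, lam ≠ a k) ∧ Phi a lam x y = 0} ⊆
      ((tangPoly a x y).roots.toFinset : Set ℝ) := by
    rintro lam ⟨h1, h2⟩
    simp only [Finset.mem_coe, Multiset.mem_toFinset, Polynomial.mem_roots hp0,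
      Polynomial.IsRoot.def]
    rw [tangPoly_eval a x y lam h1, h2, zero_mul]
  refine ⟨⟨tangPoly a x y, ?_, ?_, tangPoly_eval a x y⟩,
    (Finset.finite_toSet _).subset hsub, ?_⟩
  · rw [Polynomial.degree_eq_natDegree hp0, hnd]
  · rw [Polynomial.leadingCoeff, hnd, hc]
  · refine (Set.ncard_le_ncard hsub (Finset.finite_toSet _)).trans ?_
    rw [Set.ncard_coe_finset, ← hnd]
    exact (Multiset.toFinset_card_le _).trans (Polynomial.card_roots' _)
end
end

section
/- Suppose a line ℓ in ℝ^d is tangent to Q_α at the point P and tangent to Q_β at the point P′, where α ≠ β, α, β ∈ ℝ ∖ {a₁,…,a_d}. Then Σ_{k=1}^d P_k P′_k/((a_k−α)(a_k−β)) = 0; that is, the normal vectors N_α(P) = (P_k/(a_k−α))_k and N_β(P′) = (P′_k/(a_k−β))_k of the tangent hyperplanes to Q_α at P and to Q_β at P′ are orthogonal. -/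
noncomputable section

open scoped BigOperators

/-- A line `ℓ` is tangent to `Q_λ` at `P` if it is tangent to `Q_λ` and `P` is its unique
common point with `Q_λ`. -/
def TangentAt {d : ℕ} (a : Fin d → ℝ) (lam : ℝ) (ℓ : Set (Fin d → ℝ))
    (P : Fin d → ℝ) : Prop :=
  IsTangent a lam ℓ ∧ P ∈ ℓ ∧ Qf a lam P P = 1 ∧
    ∀ Q ∈ ℓ, Qf a lam Q Q = 1 → Q = P

theorem Qf_tangent_aux {d : ℕ} (a : Fin d → ℝ) (lam : ℝ) (ℓ : Set (Fin d → ℝ))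
    (P R : Fin d → ℝ) (hP : TangentAt a lam ℓ P) (hR : R ∈ ℓ) : Qf a lam P R = 1 := by
  obtain ⟨⟨x, y, hy, rfl, hphi⟩, ⟨t, rfl⟩, h1, -⟩ := hP
  obtain ⟨s, rfl⟩ := hR
  have key : ∀ p q : ℝ, Qf a lam (x + p • y) (x + q • y)
      = Qf a lam x x + (p + q) * Qf a lam x y + p * q * Qf a lam y y := by
    intro p q
    simp only [Qf, Finset.mul_sum, ← Finset.sum_add_distrib, Pi.add_apply, Pi.smul_apply,
      smul_eq_mul]
    refine Finset.sum_congr rfl fun k _ => ?_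
    ring
  rw [key] at h1 ⊢
  unfold Phi at hphi
  have h2 : (Qf a lam x y + t * Qf a lam y y) ^ 2 = 0 := by
    linear_combination hphi + Qf a lam y y * h1
  have h3 := pow_eq_zero_iff (two_ne_zero) |>.1 h2
  linear_combination h1 + (s - t) * h3

/-- Chasles: if a line is tangent to `Q_α` at `P` and to `Q_β` at `P′`, then the
normal vectors of the tangent hyperplanes at the points of tangency are orthogonal. -/
theorem tangent_hyperplanes_orthogonal {d : ℕ} (hd : 2 ≤ d)
    (a : Fin d → ℝ) (ha : StrictMono a)
    (α β : ℝ) (hαβ : α ≠ β) (hα : ∀ k, α ≠ a k) (hβ : ∀ k, β ≠ a k)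
    (ℓ : Set (Fin d → ℝ)) (P P' : Fin d → ℝ)
    (hP : TangentAt a α ℓ P) (hP' : TangentAt a β ℓ P') :
    ∑ k, P k * P' k / ((a k - α) * (a k - β)) = 0 := by
  have h1 := Qf_tangent_aux a α ℓ P P' hP hP'.2.1
  have h2 := Qf_tangent_aux a β ℓ P' P hP' hP.2.1
  have h3 : (α - β) * ∑ k, P k * P' k / ((a k - α) * (a k - β))
      = Qf a α P P' - Qf a β P' P := by
    simp only [Qf, Finset.mul_sum, ← Finset.sum_sub_distrib]
    refine Finset.sum_congr rfl fun k _ => ?_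
    have e1 := sub_ne_zero.2 (hα k).symm
    have e2 := sub_ne_zero.2 (hβ k).symm
    field_simp
    ring
  rw [h1, h2, sub_self] at h3
  exact (mul_eq_zero.1 h3).resolve_left (sub_ne_zero.2 hαβ)
end
end

section
/- (Double Reflection Theorem) Let μ ≠ ν be in ℝ ∖ {a₁,…,a_d} and let ℓ₁ be a line meeting Q_μ at a point x₁ and Q_ν at a point y₁, tangent to neither. Let z₁ be the pole of T_{x₁}Q_μ with respect to Q_ν (coordinates (x₁)_k(a_k−ν)/(a_k−μ)) and w₁ the pole of T_{y₁}Q_ν with respect to Q_μ (coordinates (y₁)_k(a_k−μ)/(a_k−ν)). Let x₂ be the second intersection point of the line through w₁ and x₁ with Q_μ, and y₂ the second intersection point of the line through z₁ and y₁ with Q_ν, and set ℓ₂ = line(x₁,y₂), ℓ₁′ = line(y₁,x₂), ℓ₂′ = line(x₂,y₂). Assuming these points exist and the four lines are pairwise distinct, the following hold: ℓ₁ and ℓ₂ satisfy the billiard reflection law at x₁ on Q_μ; ℓ₁ and ℓ₁′ satisfy it at y₁ on Q_ν; ℓ₂ and ℓ₂′ satisfy it at y₂ on Q_ν; and ℓ₁′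 and ℓ₂′ satisfy it at x₂ on Q_μ. -/
noncomputable section

open scoped BigOperators

/-- The pole of the tangent hyperplane at `P` to `Q_μ` with respect to `Q_ν`. -/
def poleV {d : ℕ} (a : Fin d → ℝ) (μ ν : ℝ) (P : Fin d → ℝ) : Fin d → ℝ :=
  fun k => P k * (a k - ν) / (a k - μ)

lemma core_refl {d : ℕ} (a : Fin d → ℝ) (μ ν : ℝ) (hμν : μ ≠ ν) (hμ : ∀ k, μ ≠ a k)
    (hν : ∀ k, ν ≠ a k) (P y y2 : Fin d → ℝ) (hP : Qf a μ P P = 1) (hy : Qf a ν y y = 1)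
    (hy2 : Qf a ν y2 y2 = 1) (hne : y2 ≠ y) (hPy : P ≠ y) (t : ℝ)
    (ht : y2 = y + t • (poleV a μ ν P - y)) :
    1 - t ≠ 0 ∧ y2 ≠ P ∧
      reflVec (confNormal a μ P) (y - P) = (1 / (1 - t)) • (y2 - P) := by
  have hμ' : ∀ k, a k - μ ≠ 0 := fun k => sub_ne_zero.2 (hμ k).symm
  have hν' : ∀ k, a k - ν ≠ 0 := fun k => sub_ne_zero.2 (hν k).symm
  set n := confNormal a μ P with hn
  have hnk : ∀ k, n k = P k / (a k - μ) := fun k => rfl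
  have hnn : dotp n n ≠ 0 := by
    intro h
    unfold dotp at h
    rw [Finset.sum_eq_zero_iff_of_nonneg (fun k _ => mul_self_nonneg _)] at h
    have hP0 : Qf a μ P P = 0 := by
      unfold Qf
      apply Finset.sum_eq_zero
      intro k hk
      have h1 := mul_self_eq_zero.1 (h k hk)
      rw [mul_div_assoc, ← hnk, h1, mul_zero]
    rw [hP0] at hP
    exact zero_ne_one hP
  have ht0 : t ≠ 0 := by
    rintro rfl
    apply hne
    rw [ht]; simp
  have hexp : Qf a ν y2 y2 = (1 - t) ^ 2 * Qf a ν y y + 2 * t * (1 - t) * dotp y n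
      + t ^ 2 * (Qf a μ P P + (μ - ν) * dotp n n) := by
    unfold Qf dotp
    simp only [Finset.mul_sum, ← Finset.sum_add_distrib]
    apply Finset.sum_congr rfl
    intro k _
    have h1 := hμ' k
    have h2 := hν' k
    rw [hnk, ht]
    simp only [poleV, Pi.add_apply, Pi.smul_apply, Pi.sub_apply, smul_eq_mul]
    field_simp
    ring
  have hdot : dotp (y - P) n = dotp y n - 1 := by
    rw [← hP]
    unfold Qf dotp
    rw [← Finset.sum_sub_distrib]
    apply Finset.sum_congr rfl
    intro k _
    rw [hnk, Pi.sub_apply]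
    ring
  rw [hy2, hy, hP] at hexp
  have key : 2 * dotp (y - P) n * (1 - t) + t * ((μ - ν) * dotp n n) = 0 := by
    apply mul_left_cancel₀ ht0
    rw [hdot]
    linear_combination -hexp
  have ht1 : 1 - t ≠ 0 := by
    intro h
    rw [h, mul_zero, zero_add] at key
    exact mul_ne_zero ht0 (mul_ne_zero (sub_ne_zero.2 hμν) hnn) key
  have hcoef : 2 * dotp (y - P) n / dotp n n = - (t * (μ - ν) / (1 - t)) := by
    field_simp
    linear_combination key
  have hrefl : reflVec n (y - P) = (1 / (1 - t)) • (y2 - P) := by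
    unfold reflVec
    rw [hcoef]
    funext k
    have h1 := hμ' k
    rw [ht]
    simp only [poleV, Pi.add_apply, Pi.smul_apply, Pi.sub_apply, smul_eq_mul]
    rw [hnk]
    field_simp
    ring
  refine ⟨ht1, ?_, hrefl⟩
  rintro rfl
  rw [sub_self, smul_zero] at hrefl
  have hv : y - y2 = (2 * dotp (y - y2) n / dotp n n) • n := by
    unfold reflVec at hrefl
    exact sub_eq_zero.1 hrefl
  have h2 : ∀ c : ℝ, dotp (c • n) n = c * dotp n n := by
    intro c
    unfold dotp
    rw [Finset.mul_sum]
    apply Finset.sum_congr rfl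
    intro k _
    simp only [Pi.smul_apply, smul_eq_mul]
    ring
  have h3 : dotp (y - y2) n = 2 * dotp (y - y2) n := by
    conv_lhs => rw [hv, h2]
    field_simp
  have h4 : dotp (y - y2) n = 0 := by linarith
  rw [h4, mul_zero, zero_div, zero_smul] at hv
  exact hPy (sub_eq_zero.1 hv).symm

lemma lineSet_swap {d : ℕ} (x y : Fin d → ℝ) : lineSet x (y - x) = lineSet y (x - y) := by
  ext p
  constructor
  all_goals
    rintro ⟨t, rfl⟩
    refine ⟨1 - t, ?_⟩
    funext k
    simp only [Pi.add_apply, Pi.smul_apply, Pi.sub_apply, smul_eq_mul]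
    ring

lemma mem_lineSet_base {d : ℕ} (x v : Fin d → ℝ) : x ∈ lineSet x v := ⟨0, by simp⟩

lemma core_law {d : ℕ} (a : Fin d → ℝ) (μ ν : ℝ) (hμν : μ ≠ ν) (hμ : ∀ k, μ ≠ a k)
    (hν : ∀ k, ν ≠ a k) (P y y2 : Fin d → ℝ) (hP : Qf a μ P P = 1) (hy : Qf a ν y y = 1)
    (hy2 : Qf a ν y2 y2 = 1) (hne : y2 ≠ y) (hPy : P ≠ y) (t : ℝ)
    (ht : y2 = y + t • (poleV a μ ν P - y))
    (hl : lineSet P (y - P) ≠ lineSet P (y2 - P)) :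
    ReflLaw a μ P (lineSet P (y - P)) (lineSet P (y2 - P)) := by
  obtain ⟨h1, h2, h3⟩ := core_refl a μ ν hμν hμ hν P y y2 hP hy hy2 hne hPy t ht
  exact ⟨hl, mem_lineSet_base _ _, mem_lineSet_base _ _, hP, y - P, y2 - P,
    sub_ne_zero.2 hPy.symm, sub_ne_zero.2 h2, ⟨P, rfl⟩, ⟨P, rfl⟩, _, one_div_ne_zero h1, h3⟩

/-- If `y2` is on the line from `y` to the pole of `x`, the pole of `y2` is on the line
from `x` to the pole of `y`. -/
lemma pole_transfer {d : ℕ} (a : Fin d → ℝ) (μ ν : ℝ) (hμ : ∀ k, μ ≠ a k)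
    (hν : ∀ k, ν ≠ a k) (x y x2 y2 : Fin d → ℝ) (t r : ℝ) (h1 : 1 - t ≠ 0)
    (ht : y2 = y + t • (poleV a μ ν x - y))
    (hr : x2 = x + r • (poleV a ν μ y - x)) :
    x2 = x + (r / (1 - t)) • (poleV a ν μ y2 - x) := by
  funext k
  have h2 : a k - μ ≠ 0 := sub_ne_zero.2 (hμ k).symm
  have h3 : a k - ν ≠ 0 := sub_ne_zero.2 (hν k).symm
  rw [hr, ht]
  simp only [poleV, Pi.add_apply, Pi.smul_apply, Pi.sub_apply, smul_eq_mul]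
  field_simp
  ring

/-- Double Reflection Theorem. -/
theorem double_reflection_theorem {d : ℕ} (hd : 2 ≤ d)
    (a : Fin d → ℝ) (ha : StrictMono a)
    (μ ν : ℝ) (hμν : μ ≠ ν) (hμ : ∀ k, μ ≠ a k) (hν : ∀ k, ν ≠ a k)
    (x₁ y₁ : Fin d → ℝ) (hx₁Q : Qf a μ x₁ x₁ = 1) (hy₁Q : Qf a ν y₁ y₁ = 1)
    (hx₁y₁ : x₁ ≠ y₁)
    (ℓ₁ : Set (Fin d → ℝ)) (hℓ₁ : ℓ₁ = lineSet x₁ (y₁ - x₁))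
    (hnotμ : ¬ IsTangent a μ ℓ₁) (hnotν : ¬ IsTangent a ν ℓ₁)
    (z₁ w₁ : Fin d → ℝ)
    (hz₁ : z₁ = fun k => x₁ k * (a k - ν) / (a k - μ))
    (hw₁ : w₁ = fun k => y₁ k * (a k - μ) / (a k - ν))
    (x₂ y₂ : Fin d → ℝ)
    (hx₂Q : Qf a μ x₂ x₂ = 1) (hx₂ne : x₂ ≠ x₁) (hx₂mem : x₂ ∈ lineSet x₁ (w₁ - x₁))
    (hy₂Q : Qf a ν y₂ y₂ = 1) (hy₂ne : y₂ ≠ y₁) (hy₂mem : y₂ ∈ lineSet y₁ (z₁ - y₁))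
    (ℓ₂ ℓ₁' ℓ₂' : Set (Fin d → ℝ))
    (hℓ₂ : ℓ₂ = lineSet x₁ (y₂ - x₁))
    (hℓ₁' : ℓ₁' = lineSet y₁ (x₂ - y₁))
    (hℓ₂' : ℓ₂' = lineSet x₂ (y₂ - x₂))
    (hdist : [ℓ₁, ℓ₂, ℓ₁', ℓ₂'].Pairwise (· ≠ ·)) :
    ReflLaw a μ x₁ ℓ₁ ℓ₂ ∧ ReflLaw a ν y₁ ℓ₁ ℓ₁' ∧
      ReflLaw a ν y₂ ℓ₂ ℓ₂' ∧ ReflLaw a μ x₂ ℓ₁' ℓ₂' := by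
  obtain ⟨r, hr⟩ := hx₂mem
  obtain ⟨t, ht⟩ := hy₂mem
  replace hr : x₂ = x₁ + r • (poleV a ν μ y₁ - x₁) := by rw [hr, hw₁]; rfl
  replace ht : y₂ = y₁ + t • (poleV a μ ν x₁ - y₁) := by rw [ht, hz₁]; rfl
  obtain ⟨ht1, hy₂x, -⟩ :=
    core_refl a μ ν hμν hμ hν x₁ y₁ y₂ hx₁Q hy₁Q hy₂Q hy₂ne hx₁y₁ t ht
  obtain ⟨hr1, hx₂y, -⟩ :=
    core_refl a ν μ hμν.symm hν hμ y₁ x₁ x₂ hy₁Q hx₁Q hx₂Q hx₂ne hx₁y₁.symm r hr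
  have hr' := pole_transfer a μ ν hμ hν x₁ y₁ x₂ y₂ t r ht1 ht hr
  have ht' := pole_transfer a ν μ hν hμ y₁ x₁ y₂ x₂ r t hr1 hr ht
  simp only [List.pairwise_cons, List.mem_cons, List.not_mem_nil, or_false, forall_eq_or_imp,
    forall_eq] at hdist
  obtain ⟨⟨d12, d11, -⟩, ⟨-, d22⟩, d12', -⟩ := hdist
  subst hℓ₁ hℓ₂ hℓ₁' hℓ₂'
  refine ⟨core_law a μ ν hμν hμ hν x₁ y₁ y₂ hx₁Q hy₁Q hy₂Q hy₂ne hx₁y₁ t ht d12, ?_, ?_, ?_⟩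
  · rw [lineSet_swap x₁ y₁] at d11 ⊢
    exact core_law a ν μ hμν.symm hν hμ y₁ x₁ x₂ hy₁Q hx₁Q hx₂Q hx₂ne hx₁y₁.symm r hr d11
  · rw [lineSet_swap x₁ y₂, lineSet_swap x₂ y₂] at d22 ⊢
    exact core_law a ν μ hμν.symm hν hμ y₂ x₁ x₂ hy₂Q hx₁Q hx₂Q hx₂ne hy₂x _ hr' d22
  · rw [lineSet_swap y₁ x₂] at d12' ⊢
    exact core_law a μ ν hμν hμ hν x₂ y₁ y₂ hx₂Q hy₁Q hy₂Q hy₂ne hx₂y _ ht' d12'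
end
end

section
/- Let μ ≠ ν be in ℝ ∖ {a₁,…,a_d}, let X₁ ≠ X₂ be points of Q_μ and Y₁ ≠ Y₂ points of Q_ν, the four points pairwise distinct and no three collinear. If the four tangent hyperplanes T_{X₁}Q_μ, T_{X₂}Q_μ, T_{Y₁}Q_ν, T_{Y₂}Q_ν belong to a pencil, then X₁, X₂, Y₁, Y₂ form a virtual reflection configuration. -/
noncomputable section

open scoped BigOperators

/-- Hyperplanes `{z : hᵢ·z = 1}` belong to a pencil: the vectors `hᵢ` lie on one affine line. -/
def Pencil4 {d : ℕ} (h₁ h₂ h₃ h₄ : Fin d → ℝ) : Prop :=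
  ∃ u v : Fin d → ℝ, (∃ t : ℝ, h₁ = u + t • v) ∧ (∃ t : ℝ, h₂ = u + t • v) ∧
    (∃ t : ℝ, h₃ = u + t • v) ∧ (∃ t : ℝ, h₄ = u + t • v)

/-- Points `X₁, X₂ ∈ Q_μ` and `Y₁, Y₂ ∈ Q_ν` form a virtual reflection configuration: the line
pairs `(X₁Y₁, X₁Y₂)`, `(X₂Y₁, X₂Y₂)`, `(X₁Y₁, X₂Y₁)`, `(X₁Y₂, X₂Y₂)` satisfy the billiard
reflection law at `X₁`, `X₂` on `Q_μ` and at `Y₁`, `Y₂` on `Q_ν`, respectively. -/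
def VRC {d : ℕ} (a : Fin d → ℝ) (μ ν : ℝ) (X₁ X₂ Y₁ Y₂ : Fin d → ℝ) : Prop :=
  ReflLaw a μ X₁ (lineSet X₁ (Y₁ - X₁)) (lineSet X₁ (Y₂ - X₁)) ∧
  ReflLaw a μ X₂ (lineSet X₂ (Y₁ - X₂)) (lineSet X₂ (Y₂ - X₂)) ∧
  ReflLaw a ν Y₁ (lineSet Y₁ (X₁ - Y₁)) (lineSet Y₁ (X₂ - Y₁)) ∧
  ReflLaw a ν Y₂ (lineSet Y₂ (X₁ - Y₂)) (lineSet Y₂ (X₂ - Y₂))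

/-- The reflection law at one point `P`, given the pencil condition for `P, Y₁, Y₂`. -/
theorem reflLaw_of_pencil {d : ℕ} (a : Fin d → ℝ)
    (μ ν : ℝ) (hμν : μ ≠ ν) (hμ : ∀ k, μ ≠ a k) (hν : ∀ k, ν ≠ a k)
    (P Y₁ Y₂ : Fin d → ℝ)
    (hP : Qf a μ P P = 1) (hY₁ : Qf a ν Y₁ Y₁ = 1) (hY₂ : Qf a ν Y₂ Y₂ = 1)
    (hc : ¬ Collinear ℝ ({P, Y₁, Y₂} : Set (Fin d → ℝ)))
    (u v : Fin d → ℝ) (t₀ t₁ t₂ : ℝ)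
    (h0 : confNormal a μ P = u + t₀ • v)
    (h1 : confNormal a ν Y₁ = u + t₁ • v)
    (h2 : confNormal a ν Y₂ = u + t₂ • v) :
    ReflLaw a μ P (lineSet P (Y₁ - P)) (lineSet P (Y₂ - P)) := by
  have hμ' : ∀ k, a k - μ ≠ 0 := fun k => sub_ne_zero.2 (hμ k).symm
  have hν' : ∀ k, a k - ν ≠ 0 := fun k => sub_ne_zero.2 (hν k).symm
  obtain ⟨h, hh⟩ : ∃ h, h = confNormal a μ P := ⟨_, rfl⟩
  obtain ⟨s, hs⟩ : ∃ s, s = t₁ - t₀ := ⟨_, rfl⟩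
  obtain ⟨t, ht⟩ : ∃ t, t = t₂ - t₀ := ⟨_, rfl⟩
  have eP : ∀ k, P k = (a k - μ) * h k := by
    intro k
    rw [hh]; simp only [confNormal]; field_simp [hμ' k]
  have e1 : ∀ k, Y₁ k = (a k - ν) * (h k + s * v k) := by
    intro k
    have e := congrFun h1 k
    have e' := congrFun h0 k
    rw [← hh] at e'
    simp only [confNormal, Pi.add_apply, Pi.smul_apply, smul_eq_mul] at e e'
    rw [div_eq_iff (hν' k)] at e
    rw [e, e', hs]; ring
  have e2 : ∀ k, Y₂ k = (a k - ν) * (h k + t * v k) := by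
    intro k
    have e := congrFun h2 k
    have e' := congrFun h0 k
    rw [← hh] at e'
    simp only [confNormal, Pi.add_apply, Pi.smul_apply, smul_eq_mul] at e e'
    rw [div_eq_iff (hν' k)] at e
    rw [e, e', ht]; ring
  obtain ⟨A, hA⟩ : ∃ A, A = ∑ k, v k ^ 2 * (a k - ν) := ⟨_, rfl⟩
  obtain ⟨B, hB⟩ : ∃ B, B = ∑ k, h k * v k * (a k - ν) := ⟨_, rfl⟩
  obtain ⟨H, hH⟩ : ∃ H, H = ∑ k, h k ^ 2 * (a k - ν) := ⟨_, rfl⟩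
  obtain ⟨n, hn⟩ : ∃ n, n = dotp h h := ⟨_, rfl⟩
  have q0 : H - (μ - ν) * n = 1 := by
    rw [← hP, hH, hn, dotp, Qf, Finset.mul_sum, ← Finset.sum_sub_distrib]
    refine Finset.sum_congr rfl fun k _ => ?_
    rw [eP k, eq_div_iff (hμ' k)]; ring
  have q1 : H + 2 * s * B + s ^ 2 * A = 1 := by
    rw [← hY₁, hH, hB, hA, Qf, Finset.mul_sum, Finset.mul_sum, ← Finset.sum_add_distrib,
      ← Finset.sum_add_distrib]
    refine Finset.sum_congr rfl fun k _ => ?_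
    rw [e1 k, eq_div_iff (hν' k)]; ring
  have q2 : H + 2 * t * B + t ^ 2 * A = 1 := by
    rw [← hY₂, hH, hB, hA, Qf, Finset.mul_sum, Finset.mul_sum, ← Finset.sum_add_distrib,
      ← Finset.sum_add_distrib]
    refine Finset.sum_congr rfl fun k _ => ?_
    rw [e2 k, eq_div_iff (hν' k)]; ring
  have hn0 : n ≠ 0 := by
    intro h0
    have hz : ∀ k, h k = 0 := by
      rw [hn, dotp, Finset.sum_eq_zero_iff_of_nonneg (fun k _ => mul_self_nonneg _)] at h0
      intro k
      exact mul_self_eq_zero.1 (h0 k (Finset.mem_univ k))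
    have : H = 0 := by rw [hH]; simp [hz]
    rw [this, h0] at q0; norm_num at q0
  have hm : μ - ν ≠ 0 := sub_ne_zero.2 hμν
  have hmn : (μ - ν) * n ≠ 0 := mul_ne_zero hm hn0
  have hs0 : s ≠ 0 := by
    rintro rfl
    apply hmn; linarith
  have ht0 : t ≠ 0 := by
    rintro rfl
    apply hmn; linarith
  have hY : Y₁ ≠ Y₂ := by
    rintro rfl
    apply hc; simpa using collinear_pair ℝ P Y₁
  have hst : s - t ≠ 0 := by
    intro e
    apply hY; funext k; rw [e1, e2, sub_eq_zero.1 e]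
  have hPY1 : Y₁ - P ≠ 0 := by
    intro e
    rw [sub_eq_zero] at e
    apply hc; rw [e]; simpa using collinear_pair ℝ P Y₂
  have hPY2 : Y₂ - P ≠ 0 := by
    intro e
    rw [sub_eq_zero] at e
    apply hc; rw [e, Set.pair_comm, Set.insert_comm]; simpa using collinear_pair ℝ P Y₁
  have key : (μ - ν) * n * (s + t) + 2 * B * (s * t) = 0 := by
    apply mul_left_cancel₀ hst
    linear_combination (s ^ 2 - t ^ 2) * (-q0) - t ^ 2 * q1 + s ^ 2 * q2
  have hdot : dotp (Y₁ - P) h = s * B + (μ - ν) * n := by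
    rw [hB, hn, dotp, dotp, Finset.mul_sum, Finset.mul_sum, ← Finset.sum_add_distrib]
    refine Finset.sum_congr rfl fun k _ => ?_
    rw [Pi.sub_apply, e1 k, eP k]; ring
  refine ⟨?_, ⟨0, by simp⟩, ⟨0, by simp⟩, hP, Y₁ - P, Y₂ - P, hPY1, hPY2, ⟨P, rfl⟩, ⟨P, rfl⟩,
    s / t, div_ne_zero hs0 ht0, ?_⟩
  · intro e
    have hm2 : Y₂ ∈ lineSet P (Y₁ - P) := by
      rw [e]; exact ⟨1, by simp⟩
    obtain ⟨r, hr⟩ := hm2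
    apply hc
    rw [collinear_iff_of_mem (p₀ := P) (by simp)]
    refine ⟨Y₁ - P, ?_⟩
    intro p hp
    simp only [Set.mem_insert_iff, Set.mem_singleton_iff] at hp
    rcases hp with rfl | rfl | rfl
    · exact ⟨0, by simp⟩
    · exact ⟨1, by simp⟩
    · exact ⟨r, by rw [vadd_eq_add, add_comm]; exact hr⟩
  · rw [← hh, reflVec, hdot, ← hn]
    funext k
    simp only [Pi.sub_apply, Pi.smul_apply, smul_eq_mul]
    rw [e1 k, e2 k, eP k]
    field_simp
    linear_combination (-h k) * key

/-- if the four tangent hyperplanes at `X₁, X₂ ∈ Q_μ` and `Y₁, Y₂ ∈ Q_ν` belong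
to a pencil, then the four points form a virtual reflection configuration. -/
theorem pencil_implies_vrc {d : ℕ} (hd : 2 ≤ d)
    (a : Fin d → ℝ) (ha : StrictMono a)
    (μ ν : ℝ) (hμν : μ ≠ ν) (hμ : ∀ k, μ ≠ a k) (hν : ∀ k, ν ≠ a k)
    (X₁ X₂ Y₁ Y₂ : Fin d → ℝ)
    (hX₁ : Qf a μ X₁ X₁ = 1) (hX₂ : Qf a μ X₂ X₂ = 1)
    (hY₁ : Qf a ν Y₁ Y₁ = 1) (hY₂ : Qf a ν Y₂ Y₂ = 1)
    (hd₁ : X₁ ≠ X₂) (hd₂ : Y₁ ≠ Y₂) (hd₃ : X₁ ≠ Y₁) (hd₄ : X₁ ≠ Y₂)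
    (hd₅ : X₂ ≠ Y₁) (hd₆ : X₂ ≠ Y₂)
    (hc₁ : ¬ Collinear ℝ ({X₁, X₂, Y₁} : Set (Fin d → ℝ)))
    (hc₂ : ¬ Collinear ℝ ({X₁, X₂, Y₂} : Set (Fin d → ℝ)))
    (hc₃ : ¬ Collinear ℝ ({X₁, Y₁, Y₂} : Set (Fin d → ℝ)))
    (hc₄ : ¬ Collinear ℝ ({X₂, Y₁, Y₂} : Set (Fin d → ℝ)))
    (hpencil : Pencil4 (confNormal a μ X₁) (confNormal a μ X₂)
      (confNormal a ν Y₁) (confNormal a ν Y₂)) :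
    VRC a μ ν X₁ X₂ Y₁ Y₂ := by
  obtain ⟨u, v, ⟨p, hp⟩, ⟨q, hq⟩, ⟨r, hr⟩, ⟨w, hw⟩⟩ := hpencil
  have c₁ : ({Y₁, X₁, X₂} : Set (Fin d → ℝ)) = {X₁, X₂, Y₁} := by
    rw [Set.insert_comm, Set.pair_comm]
  have c₂ : ({Y₂, X₁, X₂} : Set (Fin d → ℝ)) = {X₁, X₂, Y₂} := by
    rw [Set.insert_comm, Set.pair_comm]
  exact ⟨reflLaw_of_pencil a μ ν hμν hμ hν X₁ Y₁ Y₂ hX₁ hY₁ hY₂ hc₃ u v p r w hp hr hw,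
    reflLaw_of_pencil a μ ν hμν hμ hν X₂ Y₁ Y₂ hX₂ hY₁ hY₂ hc₄ u v q r w hq hr hw,
    reflLaw_of_pencil a ν μ hμν.symm hν hμ Y₁ X₁ X₂ hY₁ hX₁ hX₂ (c₁ ▸ hc₁) u v r p q hr hp hq,
    reflLaw_of_pencil a ν μ hμν.symm hν hμ Y₂ X₁ X₂ hY₂ hX₁ hX₂ (c₂ ▸ hc₂) u v w p q hw hp hq⟩
end
end

section
/- Suppose a line ℓ = {x + t y : t ∈ ℝ} (y ≠ 0) is tangent to the quadrics Q_{α₁}, …, Q_{α_{d−1}} of the confocal family, where α₁,…,α_{d−1} ∈ ℝ ∖ {a₁,…,a_d} are distinct. Then for every point x₀ ∈ ℓ and every λ ∈ ℝ ∖ {a₁,…,a_d} with x₀ ∈ Q_λ (i.e. for every Jacobi elliptic coordinate λ of a point of ℓ), one has P(λ) ≥ 0, where P(t) := (a₁−t)⋯(a_d−t)(α₁−t)⋯(α_{d−1}−t). -/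
noncomputable section

open scoped BigOperators

open Polynomial in
/-- The numerator polynomial of `-Φ`. -/
def numPoly {d : ℕ} (a x y : Fin d → ℝ) : ℝ[X] :=
  (∑ k, C (y k ^ 2) * ∏ i ∈ Finset.univ.erase k, (X - C (a i))) +
    ∑ i, ∑ j, C ((x i * y j - x j * y i) ^ 2 / 2) *
      ∏ k ∈ (Finset.univ.erase i).erase j, (X - C (a k))

lemma lagrange_weighted {d : ℕ} (w x y : Fin d → ℝ) :
    ∑ i, ∑ j, (x i * y j - x j * y i) ^ 2 / 2 * (w i * w j) =
      (∑ i, x i * x i * w i) * (∑ i, y i * y i * w i) - (∑ i, x i * y i * w i) ^ 2 := by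
  have h1 : (∑ i, x i * x i * w i) * (∑ i, y i * y i * w i) =
      ∑ i, ∑ j, (x i * x i * w i) * (y j * y j * w j) := Finset.sum_mul_sum _ _ _ _
  have h2 : (∑ i, x i * x i * w i) * (∑ i, y i * y i * w i) =
      ∑ i, ∑ j, (y i * y i * w i) * (x j * x j * w j) := by
    rw [mul_comm]; exact Finset.sum_mul_sum _ _ _ _
  have h3 : (∑ i, x i * y i * w i) ^ 2 =
      ∑ i, ∑ j, (x i * y i * w i) * (x j * y j * w j) := by
    rw [sq]; exact Finset.sum_mul_sum _ _ _ _
  have h4 : (∑ i, x i * x i * w i) * (∑ i, y i * y i * w i) - (∑ i, x i * y i * w i) ^ 2 =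
      (1/2) * ((∑ i, x i * x i * w i) * (∑ i, y i * y i * w i))
      + (1/2) * ((∑ i, x i * x i * w i) * (∑ i, y i * y i * w i))
      - (∑ i, x i * y i * w i) ^ 2 := by ring
  rw [h4, h3]
  nth_rewrite 1 [h1]
  rw [h2]
  simp only [Finset.mul_sum, ← Finset.sum_add_distrib, ← Finset.sum_sub_distrib]
  refine Finset.sum_congr rfl fun i _ => Finset.sum_congr rfl fun j _ => ?_
  ring

lemma numPoly_eval {d : ℕ} (a x y : Fin d → ℝ) (l : ℝ) (hl : ∀ k, l ≠ a k) :
    (numPoly a x y).eval l = -(Phi a l x y) * ∏ k, (l - a k) := by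
  have hne : ∀ k, l - a k ≠ 0 := fun k => sub_ne_zero.2 (hl k)
  set p := ∏ k, (l - a k) with hp
  have e1 : ∀ k, ∏ i ∈ Finset.univ.erase k, (l - a i) = p * (l - a k)⁻¹ := by
    intro k
    rw [eq_mul_inv_iff_mul_eq₀ (hne k)]
    exact Finset.prod_erase_mul _ _ (Finset.mem_univ k)
  have e2 : ∀ i j, j ≠ i → ∏ k ∈ (Finset.univ.erase i).erase j, (l - a k)
      = p * ((l - a i)⁻¹ * (l - a j)⁻¹) := by
    intro i j hij
    rw [← mul_assoc, ← e1, eq_mul_inv_iff_mul_eq₀ (hne j)]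
    exact Finset.prod_erase_mul _ _ (Finset.mem_erase.2 ⟨hij, Finset.mem_univ j⟩)
  have hQ : ∀ u v : Fin d → ℝ, Qf a l u v = -∑ k, u k * v k * (l - a k)⁻¹ := by
    intro u v
    unfold Qf
    rw [← Finset.sum_neg_distrib]
    refine Finset.sum_congr rfl fun k _ => ?_
    rw [← neg_sub l (a k), div_neg, div_eq_mul_inv]
  have hL := lagrange_weighted (fun k => (l - a k)⁻¹) x y
  have hS : (numPoly a x y).eval l = p * (∑ k, y k * y k * (l - a k)⁻¹) +
      p * ∑ i, ∑ j, (x i * y j - x j * y i) ^ 2 / 2 * ((l - a i)⁻¹ * (l - a j)⁻¹) := by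
    unfold numPoly
    simp only [Polynomial.eval_add, Polynomial.eval_finset_sum, Polynomial.eval_mul,
      Polynomial.eval_C, Polynomial.eval_prod, Polynomial.eval_sub, Polynomial.eval_X,
      Finset.mul_sum]
    congr 1
    · refine Finset.sum_congr rfl fun k _ => ?_
      rw [e1]; ring
    · refine Finset.sum_congr rfl fun i _ => Finset.sum_congr rfl fun j _ => ?_
      by_cases hij : j = i
      · subst hij; simp
      · rw [e2 i j hij]; ring
  rw [hS, hL]
  unfold Phi
  rw [hQ, hQ, hQ]
  ring

open Polynomial in
lemma numPoly_eq {d : ℕ} (hd : 2 ≤ d) (a x y : Fin d → ℝ)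
    (α : Fin (d - 1) → ℝ) (hα : Function.Injective α)
    (h0 : ∀ j, (numPoly a x y).eval (α j) = 0) :
    numPoly a x y = C (∑ k, y k ^ 2) * ∏ j, (X - C (α j)) := by
  have hdα : (∏ j, (X - C (α j))).degree = ((d - 1 : ℕ) : WithBot ℕ) := by
    rw [Polynomial.degree_prod]; simp
  have hmα : (∏ j, (X - C (α j))).Monic := monic_prod_X_sub_C _ _
  rw [← sub_eq_zero]
  apply Polynomial.eq_zero_of_degree_lt_of_eval_finset_eq_zero (Finset.univ.image α)
  · rw [Finset.card_image_of_injective _ hα, Finset.card_univ, Fintype.card_fin]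
    rw [← Polynomial.mem_degreeLT]
    have : numPoly a x y - C (∑ k, y k ^ 2) * ∏ j, (X - C (α j)) =
      (∑ k, C (y k ^ 2) * (∏ i ∈ Finset.univ.erase k, (X - C (a i)) - ∏ j, (X - C (α j)))) +
    ∑ i, ∑ j, C ((x i * y j - x j * y i) ^ 2 / 2) *
      ∏ k ∈ (Finset.univ.erase i).erase j, (X - C (a k)) := by
      unfold numPoly
      simp only [mul_sub, Finset.sum_sub_distrib, map_sum, Finset.sum_mul]
      ring
    rw [this]
    refine Submodule.add_mem _ (Submodule.sum_mem _ fun k _ => ?_)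
      (Submodule.sum_mem _ fun i _ => Submodule.sum_mem _ fun j _ => ?_)
    · rw [← smul_eq_C_mul]
      refine Submodule.smul_mem _ _ ?_
      rw [Polynomial.mem_degreeLT]
      have hdk : (∏ i ∈ Finset.univ.erase k, (X - C (a i))).degree
          = ((d - 1 : ℕ) : WithBot ℕ) := by
        rw [Polynomial.degree_prod]; simp
      have hmk : (∏ i ∈ Finset.univ.erase k, (X - C (a i))).Monic := monic_prod_X_sub_C _ _
      have := Polynomial.degree_sub_lt (hdk.trans hdα.symm) hmk.ne_zero (by rw [hmk, hmα])
      rwa [hdk] at this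
    · by_cases hij : j = i
      · subst hij; simp
      · rw [← smul_eq_C_mul]
        refine Submodule.smul_mem _ _ ?_
        rw [Polynomial.mem_degreeLT, Polynomial.degree_prod]
        simp only [degree_X_sub_C, Finset.sum_const, nsmul_eq_mul, mul_one]
        rw [Finset.card_erase_of_mem (Finset.mem_erase.2 ⟨hij, Finset.mem_univ j⟩),
          Finset.card_erase_of_mem (Finset.mem_univ i), Finset.card_univ, Fintype.card_fin]
        exact_mod_cast (by omega : d - 1 - 1 < d - 1)
  · intro z hz
    obtain ⟨j, -, rfl⟩ := Finset.mem_image.1 hz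
    rw [eval_sub, h0, eval_mul, eval_prod, Finset.prod_eq_zero (Finset.mem_univ j) (by simp)]
    simp

lemma Phi_shift {d : ℕ} (a x y : Fin d → ℝ) (l t : ℝ) :
    Phi a l (x + t • y) y = Phi a l x y := by
  have h1 : Qf a l (x + t • y) y = Qf a l x y + t * Qf a l y y := by
    unfold Qf
    rw [Finset.mul_sum, ← Finset.sum_add_distrib]
    refine Finset.sum_congr rfl fun k _ => ?_
    simp only [Pi.add_apply, Pi.smul_apply, smul_eq_mul]; ring
  have h2 : Qf a l (x + t • y) (x + t • y) =
      Qf a l x x + 2 * t * Qf a l x y + t ^ 2 * Qf a l y y := by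
    unfold Qf
    rw [Finset.mul_sum, Finset.mul_sum, ← Finset.sum_add_distrib, ← Finset.sum_add_distrib]
    refine Finset.sum_congr rfl fun k _ => ?_
    simp only [Pi.add_apply, Pi.smul_apply, smul_eq_mul]; ring
  unfold Phi
  rw [h1, h2]; ring

/-- on a line tangent to `Q_{α₁}, …, Q_{α_{d−1}}`, the Jacobi elliptic coordinates
`λ` of every point satisfy `P(λ) ≥ 0`, where
`P(t) = (a₁−t)⋯(a_d−t)(α₁−t)⋯(α_{d−1}−t)`. -/
theorem jacobi_coordinates_on_tangent_line {d : ℕ} (hd : 2 ≤ d)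
    (a : Fin d → ℝ) (ha : StrictMono a)
    (α : Fin (d - 1) → ℝ) (hαinj : Function.Injective α) (hαa : ∀ j k, α j ≠ a k)
    (x y : Fin d → ℝ) (hy : y ≠ 0)
    (htang : ∀ j, Phi a (α j) x y = 0) :
    ∀ x₀ ∈ lineSet x y, ∀ lam : ℝ, (∀ k, lam ≠ a k) → Qf a lam x₀ x₀ = 1 →
      0 ≤ (∏ k, (a k - lam)) * ∏ j, (α j - lam) := by
  rintro x₀ ⟨t, rfl⟩ lam hlam hQ
  have hPhi : 0 ≤ Phi a lam x y := by
    rw [← Phi_shift a x y lam t]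
    unfold Phi
    rw [hQ]
    simp only [sub_self, mul_zero, sub_zero]
    positivity
  have hE := numPoly_eq hd a x y α hαinj (fun j => by
    rw [numPoly_eval a x y _ (hαa j), htang j]; simp)
  have hE2 := numPoly_eval a x y lam hlam
  rw [hE] at hE2
  simp only [Polynomial.eval_mul, Polynomial.eval_C, Polynomial.eval_prod, Polynomial.eval_sub,
    Polynomial.eval_X] at hE2
  have hpos : 0 < ∑ k, y k ^ 2 := by
    obtain ⟨k, hk⟩ := Function.ne_iff.1 hy
    have hyk0 : y k ≠ 0 := hk
    have hyk : 0 < y k ^ 2 := by positivity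
    exact Finset.sum_pos' (fun i _ => sq_nonneg _) ⟨k, Finset.mem_univ k, hyk⟩
  have hs1 : ∏ k, (a k - lam) = (-1) ^ d * ∏ k, (lam - a k) := by
    have : ∀ k, a k - lam = (-1) * (lam - a k) := fun k => by ring
    simp only [this, Finset.prod_mul_distrib]; simp
  have hs2 : ∏ j, (α j - lam) = (-1) ^ (d - 1) * ∏ j, (lam - α j) := by
    have : ∀ j, α j - lam = (-1) * (lam - α j) := fun k => by ring
    simp only [this, Finset.prod_mul_distrib]; simp
  have hs3 : (-1 : ℝ) ^ d * (-1) ^ (d - 1) = -1 := by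
    rw [← pow_add]
    exact Odd.neg_one_pow ⟨d - 1, by omega⟩
  rw [hs1, hs2]
  have key : (∑ k, y k ^ 2) * ((-1) ^ d * (∏ k, (lam - a k)) * ((-1) ^ (d - 1) *
      ∏ j, (lam - α j))) = Phi a lam x y * (∏ k, (lam - a k)) ^ 2 := by
    calc _ = ((-1 : ℝ) ^ d * (-1) ^ (d - 1)) * (∏ k, (lam - a k)) *
        ((∑ k, y k ^ 2) * ∏ j, (lam - α j)) := by ring
      _ = _ := by rw [hs3, hE2]; ring
  refine nonneg_of_mul_nonneg_right (a := ∑ k, y k ^ 2) ?_ hpos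
  rw [key]
  positivity
end
end

section
/- Let α₁, …, α_{d−1} ∈ ℝ ∖ {a₁,…,a_d} be distinct parameters, so that the 2d−1 numbers a₁,…,a_d,α₁,…,α_{d−1} are pairwise distinct, and let b₁ < b₂ < … < b_{2d−1} be their increasing rearrangement. Then there exists a line in ℝ^d tangent to all d−1 quadrics Q_{α₁}, …, Q_{α_{d−1}} if and only if the increasing rearrangement α_{(1)} < … < α_{(d−1)} of the α's satisfies α_{(j)} ∈ {b_{2j−1}, b_{2j}} for every j = 1, …, d−1. -/
noncomputable section

open scoped BigOperators

lemma card_filter_lt {n : ℕ} (a : Fin n → ℝ) (ha : StrictMono a) (t : ℝ) (k : Fin n) :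
    a k < t ↔ (k : ℕ) < (Finset.univ.filter (fun i => a i < t)).card := by
  constructor
  · intro h
    have h1 : Finset.Iic k ⊆ Finset.univ.filter (fun i => a i < t) := by
      intro i hi
      simp only [Finset.mem_Iic] at hi
      simp only [Finset.mem_filter, Finset.mem_univ, true_and]
      exact lt_of_le_of_lt (ha.monotone hi) h
    have h2 := Finset.card_le_card h1
    rw [Fin.card_Iic] at h2
    omega
  · intro h
    by_contra hn
    have h1 : Finset.univ.filter (fun i => a i < t) ⊆ Finset.Iio k := by
      intro i hi
      simp only [Finset.mem_filter, Finset.mem_univ, true_and] at hi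
      simp only [Finset.mem_Iio]
      by_contra hk
      exact hn (lt_of_le_of_lt (ha.monotone (not_lt.1 hk)) hi)
    have h2 := Finset.card_le_card h1
    rw [Fin.card_Iio] at h2
    omega

lemma card_filter_self {n : ℕ} (a : Fin n → ℝ) (ha : StrictMono a) (k : Fin n) :
    (Finset.univ.filter (fun i => a i < a k)).card = k := by
  have : Finset.univ.filter (fun i => a i < a k) = Finset.Iio k := by
    ext i; simp [ha.lt_iff_lt]
  rw [this, Fin.card_Iio]

lemma card_image_filter {n : ℕ} (a : Fin n → ℝ) (ha : StrictMono a) (t : ℝ) :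
    ((Finset.univ.image a).filter (fun v => v < t)).card =
      (Finset.univ.filter (fun i => a i < t)).card := by
  rw [Finset.filter_image, Finset.card_image_of_injective _ ha.injective]

lemma rank_eq {n p m : ℕ} (a : Fin p → ℝ) (ha : StrictMono a) (β : Fin n → ℝ) (hβ : StrictMono β)
    (hβa : ∀ j k, β j ≠ a k) (b : Fin m → ℝ) (hb : StrictMono b)
    (hbr : Set.range b = Set.range a ∪ Set.range β) (j : Fin n) (r : Fin m) (hr : b r = β j) :
    (r : ℕ) = j + (Finset.univ.filter (fun i => a i < β j)).card := by
  have h1 : Finset.univ.image b = Finset.univ.image a ∪ Finset.univ.image β := by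
    apply Finset.coe_injective
    simpa using hbr
  have h2 := congrArg (fun s => (s.filter (fun v => v < β j)).card) h1
  simp only [Finset.filter_union] at h2
  rw [Finset.card_union_of_disjoint, card_image_filter b hb, card_image_filter a ha,
    card_image_filter β hβ, card_filter_self β hβ, ← hr, card_filter_self b hb] at h2
  · rw [← hr]; omega
  · rw [Finset.disjoint_left]
    intro v hv hv'
    simp only [Finset.mem_filter, Finset.mem_image, Finset.mem_univ, true_and] at hv hv'
    obtain ⟨⟨k, rfl⟩, -⟩ := hv
    obtain ⟨⟨i, hi⟩, -⟩ := hv'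
    exact hβa i k hi

lemma comb {n p m : ℕ} (a : Fin p → ℝ) (ha : StrictMono a) (β : Fin n → ℝ) (hβ : StrictMono β)
    (hp : n + 1 = p)
    (hβa : ∀ j k, β j ≠ a k) (b : Fin m → ℝ) (hb : StrictMono b)
    (hbr : Set.range b = Set.range a ∪ Set.range β) (j : Fin n) (h0 : 2 * (j : ℕ) < m)
    (h1 : 2 * (j : ℕ) + 1 < m) :
    (β j = b ⟨2 * (j : ℕ), h0⟩ ∨ β j = b ⟨2 * (j : ℕ) + 1, h1⟩) ↔
      ((∀ k : Fin p, (k : ℕ) < j → a k < β j) ∧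
        (∀ k : Fin p, (j : ℕ) + 1 ≤ k → β j < a k)) := by
  obtain ⟨r, hr⟩ : β j ∈ Set.range b := by rw [hbr]; exact Or.inr ⟨j, rfl⟩
  have hrk := rank_eq a ha β hβ hβa b hb hbr j r hr
  have key := card_filter_lt a ha (β j)
  set N := (Finset.univ.filter (fun i => a i < β j)).card
  have e : (β j = b ⟨2 * (j : ℕ), h0⟩ ∨ β j = b ⟨2 * (j : ℕ) + 1, h1⟩) ↔
      (N = j ∨ N = j + 1) := by
    rw [← hr, hb.injective.eq_iff, hb.injective.eq_iff, Fin.ext_iff, Fin.ext_iff]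
    simp only
    omega
  rw [e]
  have hj := j.isLt
  constructor
  · intro h
    refine ⟨fun k hk => (key k).2 (by omega), fun k hk => ?_⟩
    refine lt_of_le_of_ne (not_lt.1 fun h' => ?_) (hβa j k)
    have := (key k).1 h'
    omega
  · rintro ⟨hA, hB⟩
    have l1 : (j : ℕ) ≤ N := by
      by_contra hc
      have := (key ⟨N, by omega⟩).1 (hA _ (by simpa using hc))
      simp at this
    have l2 : N ≤ j + 1 := by
      by_contra hc
      have h3 := hB ⟨j + 1, by omega⟩ (by simp)
      exact absurd ((key ⟨j + 1, by omega⟩).2 (by simp; omega)) (not_lt.2 h3.le)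
    omega

lemma y_exists {n : ℕ} (hn : 1 ≤ n) (a : Fin (n + 1) → ℝ) (ha : StrictMono a) (c : Fin n → ℝ)
    (h1 : ∀ j : Fin n, a j.castSucc < c j) (h2 : ∀ j : Fin n, c j < a j.succ) :
    ∃ y : Fin (n + 1) → ℝ, (∀ k, 0 < y k) ∧ ∀ j, ∑ k, y k ^ 2 / (a k - c j) = 0 := by
  classical
  have hca : ∀ k j, a k - c j ≠ 0 := by
    intro k j h
    rcases le_or_gt k j.castSucc with hk | hk
    · linarith [ha.monotone hk, h1 j]
    · linarith [ha.monotone (Fin.castSucc_lt_iff_succ_le.1 hk), h2 j]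
  let W : Fin (n + 1) → ℝ := fun k =>
    (∏ j, (a k - c j)) / ∏ l ∈ Finset.univ.erase k, (a k - a l)
  have hW : ∀ k, 0 < W k := by
    intro k
    have e : ∏ l ∈ Finset.univ.erase k, (a k - a l) = ∏ j : Fin n, (a k - a (k.succAbove j)) := by
      have h0 : Finset.univ.erase k = Finset.univ.map k.succAboveEmb := by
        ext l
        simp only [Finset.mem_erase, Finset.mem_univ, and_true, Finset.mem_map, true_and]
        exact ⟨fun h => Fin.exists_succAbove_eq h, by
          rintro ⟨i, rfl⟩; exact Fin.succAbove_ne _ _⟩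
      rw [h0, Finset.prod_map]
      rfl
    simp only [W]
    rw [e, ← Finset.prod_div_distrib]
    apply Finset.prod_pos
    intro j _
    rcases lt_or_ge j.castSucc k with hk | hk
    · rw [Fin.succAbove_of_castSucc_lt _ _ hk]
      have := ha.monotone (Fin.castSucc_lt_iff_succ_le.1 hk)
      apply div_pos
      · linarith [h2 j]
      · linarith [ha hk]
    · rw [Fin.succAbove_of_le_castSucc _ _ hk]
      have := ha.monotone hk
      apply div_pos_of_neg_of_neg
      · linarith [h1 j]
      · linarith [h1 j, h2 j]
  refine ⟨fun k => Real.sqrt (W k), fun k => Real.sqrt_pos.2 (hW k), fun j => ?_⟩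
  have hP := Lagrange.coeff_eq_sum (s := (Finset.univ : Finset (Fin (n + 1)))) (v := a)
    ha.injective.injOn
    (P := ∏ i ∈ Finset.univ.erase j, (Polynomial.X - Polynomial.C (c i))) (by
      rw [Polynomial.degree_prod]
      simp
      norm_cast
      omega)
  rw [Polynomial.coeff_eq_zero_of_degree_lt] at hP
  · rw [hP]
    apply Finset.sum_congr rfl
    intro k _
    rw [Real.sq_sqrt (hW k).le]
    simp only [W, Polynomial.eval_prod, Polynomial.eval_sub, Polynomial.eval_X, Polynomial.eval_C]
    rw [← Finset.mul_prod_erase Finset.univ _ (Finset.mem_univ j), div_right_comm,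
      mul_div_cancel_left₀ _ (hca k j)]
  · rw [Polynomial.degree_prod]
    simp
    norm_cast

lemma w_exists {n : ℕ} (β c : Fin n → ℝ)
    (h1 : ∀ j : Fin n, β j < c j) (h2 : ∀ i j : Fin n, i < j → c i < β j) :
    ∃ w : Fin n → ℝ, (∀ k, 0 < w k) ∧ ∀ j, ∑ k, w k / (c k - β j) = 1 := by
  classical
  have hc : StrictMono c := fun i j h => (h2 i j h).trans (h1 j)
  have hca : ∀ k j, c k - β j ≠ 0 := by
    intro k j h
    rcases lt_or_ge k j with hk | hk
    · linarith [h2 k j hk]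
    · linarith [hc.monotone hk, h1 j]
  let W : Fin n → ℝ := fun k =>
    (∏ j, (c k - β j)) / ∏ l ∈ Finset.univ.erase k, (c k - c l)
  have hW : ∀ k, 0 < W k := by
    intro k
    simp only [W]
    rw [← Finset.mul_prod_erase Finset.univ _ (Finset.mem_univ k), mul_div_assoc,
      ← Finset.prod_div_distrib]
    apply mul_pos (by linarith [h1 k])
    apply Finset.prod_pos
    intro j hj
    rcases lt_or_gt_of_ne (Finset.ne_of_mem_erase hj) with hk | hk
    · apply div_pos
      · linarith [h1 j, hc hk]
      · linarith [hc hk]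
    · apply div_pos_of_neg_of_neg
      · linarith [h2 _ _ hk]
      · linarith [hc hk]
  refine ⟨W, hW, fun j => ?_⟩
  have hj := j.isLt
  have hM : (∏ i ∈ Finset.univ.erase j, (Polynomial.X - Polynomial.C (β i))).Monic :=
    Polynomial.monic_prod_of_monic _ _ fun i _ => Polynomial.monic_X_sub_C _
  have hP := Lagrange.leadingCoeff_eq_sum (s := (Finset.univ : Finset (Fin n))) (v := c)
    hc.injective.injOn
    (P := ∏ i ∈ Finset.univ.erase j, (Polynomial.X - Polynomial.C (β i))) (by
      rw [Polynomial.degree_prod]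
      simp
      norm_cast
      omega)
  rw [hM.leadingCoeff] at hP
  rw [hP]
  apply Finset.sum_congr rfl
  intro k _
  simp only [W, Polynomial.eval_prod, Polynomial.eval_sub, Polynomial.eval_X, Polynomial.eval_C]
  rw [← Finset.mul_prod_erase Finset.univ _ (Finset.mem_univ j), div_right_comm,
    mul_div_cancel_left₀ _ (hca k j)]

lemma suff {n : ℕ} (hn : 1 ≤ n) (a : Fin (n + 1) → ℝ) (ha : StrictMono a) (β : Fin n → ℝ)
    (hβ : StrictMono β) (hβa : ∀ j k, β j ≠ a k)
    (hA : ∀ (j : Fin n) (k : Fin (n + 1)), (k : ℕ) < j → a k < β j)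
    (hB : ∀ (j : Fin n) (k : Fin (n + 1)), (j : ℕ) + 1 ≤ k → β j < a k) :
    ∃ x y : Fin (n + 1) → ℝ, y ≠ 0 ∧ ∀ j, Phi a (β j) x y = 0 := by
  classical
  have hc : ∀ j : Fin n, ∃ m : ℝ, (a j.castSucc < m ∧ β j < m) ∧ m < a j.succ ∧
      ∀ i, j < i → m < β i := by
    intro j
    obtain ⟨m, hm1, hm2⟩ := Order.exists_between_finsets
      ({a j.castSucc, β j} : Finset ℝ)
      (insert (a j.succ) ((Finset.univ.filter (fun i => j < i)).image β)) (by
        intro p hp q hq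
        simp only [Finset.mem_insert, Finset.mem_singleton, Finset.mem_image, Finset.mem_filter,
          Finset.mem_univ, true_and] at hp hq
        rcases hp with rfl | rfl <;> rcases hq with rfl | ⟨i, hi, rfl⟩
        · exact ha (Fin.castSucc_lt_succ)
        · exact hA _ _ (by simpa using hi)
        · exact hB _ _ (by simp)
        · exact hβ hi)
    refine ⟨m, ⟨hm1 _ (by simp), hm1 _ (by simp)⟩, hm2 _ (by simp), fun i hi => hm2 _ ?_⟩
    simp only [Finset.mem_insert, Finset.mem_image, Finset.mem_filter, Finset.mem_univ, true_and]
    exact Or.inr ⟨i, hi, rfl⟩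
  choose c hc1 hc2 hc3 using hc
  obtain ⟨y, hy, hyc⟩ := y_exists hn a ha c (fun j => (hc1 j).1) hc2
  obtain ⟨w, hw, hwc⟩ := w_exists β c (fun j => (hc1 j).2) (fun i j h => hc3 i j h)
  have hcm : StrictMono c := fun i j h => (hc3 i j h).trans (hc1 j).2
  have hca : ∀ k j, a k - c j ≠ 0 := by
    intro k j h
    rcases le_or_gt k j.castSucc with hk | hk
    · linarith [ha.monotone hk, (hc1 j).1]
    · linarith [ha.monotone (Fin.castSucc_lt_iff_succ_le.1 hk), hc2 j]
  have hcb : ∀ k j, c k - β j ≠ 0 := by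
    intro k j h
    rcases lt_or_ge k j with hk | hk
    · linarith [hc3 k j hk]
    · linarith [hcm.monotone hk, (hc1 j).2]
  let G : Fin n → ℝ := fun i => ∑ k, y k ^ 2 / (a k - c i) ^ 2
  have hG : ∀ i, 0 < G i := fun i => Finset.sum_pos (fun k _ => by
    have := hca k i
    have := hy k
    positivity) ⟨0, Finset.mem_univ _⟩
  have hG' : ∀ i j, ∑ k, y k ^ 2 / ((a k - c i) * (a k - c j)) = if i = j then G i else 0 := by
    intro i j
    split_ifs with h
    · subst h
      simp only [G, sq]
    · have hne : c i - c j ≠ 0 := sub_ne_zero.2 (hcm.injective.ne h)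
      have : ∑ k, y k ^ 2 / ((a k - c i) * (a k - c j)) =
          (∑ k, y k ^ 2 / (a k - c i) - ∑ k, y k ^ 2 / (a k - c j)) / (c i - c j) := by
        rw [← Finset.sum_sub_distrib, Finset.sum_div]
        apply Finset.sum_congr rfl
        intro k _
        have := hca k i
        have := hca k j
        field_simp
        ring
      rw [this, hyc, hyc]; simp
  let s : Fin n → ℝ := fun i => Real.sqrt (w i / G i)
  have hs : ∀ i, s i ^ 2 * G i = w i := by
    intro i
    simp only [s]
    rw [Real.sq_sqrt (div_pos (hw i) (hG i)).le, div_mul_cancel₀ _ (hG i).ne']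
  refine ⟨fun k => ∑ i, s i * (y k / (a k - c i)), y, ?_, ?_⟩
  · intro h
    have := hy 0
    rw [h] at this
    simp at this
  intro j
  set L := β j with hL
  have haL : ∀ k, a k - L ≠ 0 := fun k => sub_ne_zero.2 (hβa j k).symm
  have hcL : ∀ i, c i - L ≠ 0 := fun i => hcb i j
  let S := Qf a L y y
  let T := ∑ i, s i / (L - c i)
  have H1 : ∀ i, ∑ k, y k ^ 2 / ((a k - c i) * (a k - L)) = S / (L - c i) := by
    intro i
    have h3 : L - c i ≠ 0 := fun h => hcL i (by linarith)
    have : ∑ k, y k ^ 2 / ((a k - c i) * (a k - L)) =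
        (S - ∑ k, y k ^ 2 / (a k - c i)) / (L - c i) := by
      simp only [S, Qf]
      rw [← Finset.sum_sub_distrib, Finset.sum_div]
      apply Finset.sum_congr rfl
      intro k _
      have := hca k i
      have := haL k
      field_simp
      ring
    rw [this, hyc, sub_zero]
  have H2 : ∀ i l, ∑ k, y k ^ 2 / ((a k - c i) * (a k - c l) * (a k - L)) =
      S / ((L - c i) * (L - c l)) + if i = l then G i / (c i - L) else 0 := by
    intro i l
    have h3 : L - c i ≠ 0 := fun h => hcL i (by linarith)
    have h4 : L - c l ≠ 0 := fun h => hcL l (by linarith)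
    have : ∑ k, y k ^ 2 / ((a k - c i) * (a k - c l) * (a k - L)) =
        (∑ k, y k ^ 2 / ((a k - c i) * (a k - L))
          - ∑ k, y k ^ 2 / ((a k - c i) * (a k - c l))) / (L - c l) := by
      rw [← Finset.sum_sub_distrib, Finset.sum_div]
      apply Finset.sum_congr rfl
      intro k _
      have := hca k i
      have := hca k l
      have := haL k
      field_simp
      ring
    rw [this, H1, hG']
    split_ifs with h
    · subst h
      have := hcL i
      rw [sub_div, div_div, sub_eq_add_neg, ← div_neg, neg_sub]
    · rw [sub_zero, div_div, add_zero]
  have E1 : Qf a L (fun k => ∑ i, s i * (y k / (a k - c i))) y = S * T := by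
    have : Qf a L (fun k => ∑ i, s i * (y k / (a k - c i))) y =
        ∑ i, s i * ∑ k, y k ^ 2 / ((a k - c i) * (a k - L)) := by
      simp only [Qf, Finset.mul_sum]
      rw [Finset.sum_comm]
      apply Finset.sum_congr rfl
      intro k _
      rw [Finset.sum_mul, Finset.sum_div]
      apply Finset.sum_congr rfl
      intro i _
      have := hca k i
      have := haL k
      field_simp
    rw [this]
    simp only [H1, T, Finset.mul_sum]
    apply Finset.sum_congr rfl
    intro i _
    ring
  have E2 : Qf a L (fun k => ∑ i, s i * (y k / (a k - c i)))
      (fun k => ∑ i, s i * (y k / (a k - c i))) = S * T ^ 2 + 1 := by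
    have : Qf a L (fun k => ∑ i, s i * (y k / (a k - c i)))
        (fun k => ∑ i, s i * (y k / (a k - c i))) =
        ∑ i, ∑ l, s i * s l * ∑ k, y k ^ 2 / ((a k - c i) * (a k - c l) * (a k - L)) := by
      simp only [Qf, Finset.mul_sum]
      simp_rw [Finset.sum_comm (s := (Finset.univ : Finset (Fin n)))
        (t := (Finset.univ : Finset (Fin (n + 1))))]
      apply Finset.sum_congr rfl
      intro k _
      rw [Finset.sum_div, Finset.sum_comm]
      apply Finset.sum_congr rfl
      intro i _
      rw [Finset.sum_mul, Finset.sum_div]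
      apply Finset.sum_congr rfl
      intro l _
      have := hca k i
      have := hca k l
      have := haL k
      field_simp
    rw [this]
    simp only [H2, mul_add, Finset.sum_add_distrib, mul_ite, mul_zero, Finset.sum_ite_eq,
      Finset.mem_univ, if_true]
    congr 1
    · simp only [T, sq, Finset.sum_mul, Finset.mul_sum]
      rw [Finset.sum_comm]
      apply Finset.sum_congr rfl
      intro i _
      apply Finset.sum_congr rfl
      intro l _
      field_simp
    · rw [← hwc j]
      apply Finset.sum_congr rfl
      intro i _
      rw [← hs i]
      ring
  simp only [Phi]
  rw [E1, E2]
  simp only [S]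
  ring

lemma neck {p : ℕ} (a : Fin p → ℝ) (L : ℝ) (x y : Fin p → ℝ) (hy : y ≠ 0)
    (hL : ∀ k, L ≠ a k) (h : Phi a L x y = 0) :
    ∃ (z : Fin p → ℝ) (t : ℝ), z ≠ 0 ∧ dotp z y = 0 ∧
      ∀ k, (a k - L) * z k = dotp z x * x k + t * y k := by
  have haL : ∀ k, a k - L ≠ 0 := fun k => sub_ne_zero.2 (hL k).symm
  obtain ⟨s, t, hst, h1, h2⟩ : ∃ s t : ℝ, (s ≠ 0 ∨ t ≠ 0) ∧
      s * (Qf a L x x - 1) + t * Qf a L x y = 0 ∧ s * Qf a L x y + t * Qf a L y y = 0 := by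
    by_cases h0 : Qf a L y y = 0 ∧ Qf a L x y = 0
    · exact ⟨0, 1, Or.inr one_ne_zero, by rw [h0.2]; ring, by rw [h0.1]; ring⟩
    · refine ⟨Qf a L y y, -Qf a L x y, ?_, ?_, by ring⟩
      · by_contra hc
        push Not at hc
        exact h0 ⟨hc.1, neg_eq_zero.1 hc.2⟩
      · unfold Phi at h
        linarith
  let z : Fin p → ℝ := fun k => (s * x k + t * y k) / (a k - L)
  have hz : ∀ k, (a k - L) * z k = s * x k + t * y k := fun k => mul_div_cancel₀ _ (haL k)
  have hzy : dotp z y = 0 := by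
    rw [← h2]
    simp only [dotp, Qf, Finset.mul_sum, ← Finset.sum_add_distrib, z]
    exact Finset.sum_congr rfl fun k _ => by ring
  have hzx : dotp z x = s := by
    have : dotp z x = s * Qf a L x x + t * Qf a L x y := by
      simp only [dotp, Qf, Finset.mul_sum, ← Finset.sum_add_distrib, z]
      exact Finset.sum_congr rfl fun k _ => by ring
    linarith
  refine ⟨z, t, ?_, hzy, ?_⟩
  · intro h0
    have hs : s = 0 := by rw [← hzx, h0]; simp [dotp]
    have ht : t ≠ 0 := by
      rcases hst with h | h
      · exact absurd hs h
      · exact h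
    apply hy
    funext k
    have := hz k
    rw [h0, hs] at this
    simp at this
    rcases this with h | h
    · exact absurd h ht
    · simpa using h
  · intro k
    rw [hz, hzx]

lemma exists_ker {n : ℕ} {ι : Type} [Fintype ι] (hι : Fintype.card ι < n)
    (f : ι → ((Fin n → ℝ) →ₗ[ℝ] ℝ)) : ∃ c : Fin n → ℝ, c ≠ 0 ∧ ∀ i, f i c = 0 := by
  have h := LinearMap.ker_ne_bot_of_finrank_lt (f := LinearMap.pi f) (by simpa using hι)
  obtain ⟨c, hc, hc0⟩ := Submodule.exists_mem_ne_zero_of_ne_bot h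
  refine ⟨c, hc0, fun i => ?_⟩
  exact congrFun (LinearMap.mem_ker.1 hc) i

lemma nec {n : ℕ} (a : Fin (n + 1) → ℝ) (ha : StrictMono a) (β : Fin n → ℝ)
    (hβ : StrictMono β) (hβa : ∀ j k, β j ≠ a k)
    (x y : Fin (n + 1) → ℝ) (hy : y ≠ 0) (h : ∀ j, Phi a (β j) x y = 0) (j : Fin n) :
    (∀ k : Fin (n + 1), (k : ℕ) < j → a k < β j) ∧
    (∀ k : Fin (n + 1), (j : ℕ) + 1 ≤ k → β j < a k) := by
  choose z t hz0 hzy hz using fun j => neck a (β j) x y hy (hβa j) (h j)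
  have pair : ∀ i l, ∑ k, a k * z i k * z l k - dotp (z i) x * dotp (z l) x
      = β i * dotp (z i) (z l) := by
    intro i l
    have : ∑ k, a k * z i k * z l k - dotp (z i) x * dotp (z l) x - β i * dotp (z i) (z l)
        = t i * dotp (z l) y := by
      generalize hX : dotp (z i) x = X
      simp only [dotp, Finset.mul_sum, ← Finset.sum_sub_distrib]
      refine Finset.sum_congr rfl fun k _ => ?_
      have := hz i k
      rw [hX] at this
      linear_combination z l k * this
    rw [hzy l] at this
    linarith
  have dsymm : ∀ u v : Fin (n + 1) → ℝ, dotp u v = dotp v u := fun u v =>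
    Finset.sum_congr rfl fun k _ => mul_comm _ _
  have orth : ∀ i l, i ≠ l → dotp (z i) (z l) = 0 := by
    intro i l hil
    have e1 := pair i l
    have e2 := pair l i
    have e3 : ∑ k, a k * z i k * z l k = ∑ k, a k * z l k * z i k :=
      Finset.sum_congr rfl fun k _ => by ring
    rw [dsymm (z l) (z i)] at e2
    have : (β i - β l) * dotp (z i) (z l) = 0 := by linarith
    rcases mul_eq_zero.1 this with h | h
    · exact absurd (sub_eq_zero.1 h) (hβ.injective.ne hil)
    · exact h
  have npos : ∀ i, 0 < dotp (z i) (z i) := by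
    intro i
    have hnn : ∀ k ∈ Finset.univ, 0 ≤ z i k * z i k := fun k _ => mul_self_nonneg _
    refine lt_of_le_of_ne (Finset.sum_nonneg hnn) fun h0 => hz0 i ?_
    funext k
    have := (Finset.sum_eq_zero_iff_of_nonneg hnn).1 h0.symm k (Finset.mem_univ k)
    simpa using this
  -- the combination
  have main : ∀ (c : Fin n → ℝ) (v : Fin (n + 1) → ℝ) (_ : ∀ k, v k = ∑ i, c i * z i k) (μ : ℝ),
      ∑ k, (a k - μ) * v k ^ 2 - (dotp v x) ^ 2 =
        ∑ i, c i ^ 2 * (β i - μ) * dotp (z i) (z i) := by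
    intro c v hv μ
    have hdot : ∀ u : Fin (n + 1) → ℝ, dotp u v = ∑ i, c i * dotp u (z i) := by
      intro u
      simp only [dotp, hv, Finset.mul_sum]
      rw [Finset.sum_comm]
      exact Finset.sum_congr rfl fun i _ => Finset.sum_congr rfl fun k _ => by ring
    have hzv : ∀ i, dotp (z i) v = c i * dotp (z i) (z i) := by
      intro i
      rw [hdot, Finset.sum_eq_single i]
      · intro l _ hl
        rw [orth i l hl.symm, mul_zero]
      · simp
    have hyv : dotp y v = 0 := by
      rw [hdot]
      exact Finset.sum_eq_zero fun i _ => by rw [dsymm, hzy, mul_zero]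
    have hi : ∀ i, ∑ k, (a k - μ) * z i k * v k - dotp (z i) x * dotp x v =
        (β i - μ) * (c i * dotp (z i) (z i)) := by
      intro i
      have : ∑ k, (a k - μ) * z i k * v k - dotp (z i) x * dotp x v -
          (β i - μ) * dotp (z i) v = t i * dotp y v := by
        generalize hX : dotp (z i) x = X
        simp only [dotp, Finset.mul_sum, ← Finset.sum_sub_distrib]
        refine Finset.sum_congr rfl fun k _ => ?_
        have := hz i k
        rw [hX] at this
        linear_combination v k * this
      rw [hyv, hzv] at this
      linarith
    have e1 : ∑ k, (a k - μ) * v k ^ 2 = ∑ i, c i * ∑ k, (a k - μ) * z i k * v k := by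
      simp only [Finset.mul_sum]
      rw [Finset.sum_comm]
      refine Finset.sum_congr rfl fun k _ => ?_
      rw [sq, ← mul_assoc]
      nth_rewrite 1 [hv k]
      rw [Finset.mul_sum, Finset.sum_mul]
      exact Finset.sum_congr rfl fun i _ => by ring
    have e2 : dotp v x ^ 2 = ∑ i, c i * (dotp (z i) x * dotp x v) := by
      rw [sq, dsymm v x]
      nth_rewrite 1 [hdot x]
      rw [Finset.sum_mul]
      refine Finset.sum_congr rfl fun i _ => ?_
      rw [dsymm x (z i)]
      ring
    rw [e1, e2, ← Finset.sum_sub_distrib]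
    refine Finset.sum_congr rfl fun i _ => ?_
    rw [← mul_sub, hi]
    ring
  -- coordinate functionals
  let V : Fin (n + 1) → ((Fin n → ℝ) →ₗ[ℝ] ℝ) := fun k =>
    ∑ i, z i k • (LinearMap.proj i : (Fin n → ℝ) →ₗ[ℝ] ℝ)
  have hV : ∀ k c, V k c = ∑ i, c i * z i k := by
    intro k c
    simp [V, mul_comm]
  have hjn := j.isLt
  constructor
  · intro k hk
    by_contra hlt
    have hlt : β j < a k := lt_of_le_of_ne (not_lt.1 hlt) (hβa j k)
    obtain ⟨c, hc0, hc⟩ := exists_ker (n := n) (ι := Unit ⊕ (Fin (n - 1 - j) ⊕ Fin k))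
      (by simp; omega)
      (Sum.elim (fun _ => ∑ q, x q • V q)
        (Sum.elim (fun q => LinearMap.proj (⟨j + 1 + q, by omega⟩ : Fin n))
          (fun q => V ⟨q, by omega⟩)))
    have c1 : dotp (fun q => ∑ i, c i * z i q) x = 0 := by
      have := hc (Sum.inl ())
      simp only [Sum.elim_inl, LinearMap.sum_apply, LinearMap.smul_apply, smul_eq_mul, hV] at this
      rw [← this]
      exact Finset.sum_congr rfl fun q _ => mul_comm _ _
    have c2 : ∀ i : Fin n, j < i → c i = 0 := by
      intro i hi
      have hi' : (j : ℕ) < i := hi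
      have := hc (Sum.inr (Sum.inl ⟨i - (j + 1), by omega⟩))
      simp only [Sum.elim_inr, Sum.elim_inl, LinearMap.proj_apply] at this
      rw [← this]
      congr 1
      ext
      simp only
      omega
    have c3 : ∀ q : Fin (n + 1), q < k → ∑ i, c i * z i q = 0 := by
      intro q hq
      have := hc (Sum.inr (Sum.inr ⟨q, hq⟩))
      simpa only [Sum.elim_inr, hV] using this
    have e := main c _ (fun _ => rfl) (a k)
    rw [c1] at e
    have l1 : 0 ≤ ∑ q, (a q - a k) * (∑ i, c i * z i q) ^ 2 := by
      refine Finset.sum_nonneg fun q _ => ?_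
      rcases lt_or_ge q k with hq | hq
      · rw [c3 q hq]; simp
      · exact mul_nonneg (sub_nonneg.2 (ha.monotone hq)) (sq_nonneg _)
    have l2 : ∑ i, c i ^ 2 * (β i - a k) * dotp (z i) (z i) < 0 := by
      obtain ⟨i, hi⟩ := Function.ne_iff.1 hc0
      have hb : ∀ i, c i ≠ 0 → β i - a k < 0 := by
        intro i hi
        have : i ≤ j := not_lt.1 fun h => hi (c2 i h)
        linarith [hβ.monotone this]
      have hneg : ∀ i, c i ≠ 0 → c i ^ 2 * (β i - a k) * dotp (z i) (z i) < 0 := fun i hi =>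
        mul_neg_of_neg_of_pos (mul_neg_of_pos_of_neg (by positivity) (hb i hi)) (npos i)
      refine Finset.sum_neg' (fun i _ => ?_) ⟨i, Finset.mem_univ i, hneg i hi⟩
      by_cases h : c i = 0
      · rw [h]; simp
      · exact (hneg i h).le
    linarith
  · intro k hk
    by_contra hlt
    have hlt : a k < β j := lt_of_le_of_ne (not_lt.1 hlt) (hβa j k).symm
    obtain ⟨c, hc0, hc⟩ := exists_ker (n := n) (ι := Fin j ⊕ Fin (n - k))
      (by simp; omega)
      (Sum.elim (fun q => LinearMap.proj (⟨q, by omega⟩ : Fin n))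
          (fun q => V ⟨k + 1 + q, by omega⟩))
    have c2 : ∀ i : Fin n, i < j → c i = 0 := by
      intro i hi
      have := hc (Sum.inl ⟨i, hi⟩)
      simpa only [Sum.elim_inl, LinearMap.proj_apply] using this
    have c3 : ∀ q : Fin (n + 1), k < q → ∑ i, c i * z i q = 0 := by
      intro q hq
      have hq' : (k : ℕ) < q := hq
      have := hc (Sum.inr ⟨q - (k + 1), by omega⟩)
      simp only [Sum.elim_inr, hV] at this
      rw [← this]
      have e : (⟨k + 1 + (q - (k + 1)), by omega⟩ : Fin (n + 1)) = q := by
        ext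
        simp only
        omega
      rw [e]
    have e := main c _ (fun _ => rfl) (a k)
    have l1 : ∑ q, (a q - a k) * (∑ i, c i * z i q) ^ 2 ≤ 0 := by
      refine Finset.sum_nonpos fun q _ => ?_
      rcases lt_or_ge k q with hq | hq
      · rw [c3 q hq]; simp
      · exact mul_nonpos_of_nonpos_of_nonneg (sub_nonpos.2 (ha.monotone hq)) (sq_nonneg _)
    have l2 : 0 < ∑ i, c i ^ 2 * (β i - a k) * dotp (z i) (z i) := by
      obtain ⟨i, hi⟩ := Function.ne_iff.1 hc0
      have hb : ∀ i, c i ≠ 0 → 0 < β i - a k := by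
        intro i hi
        have : j ≤ i := not_lt.1 fun h => hi (c2 i h)
        linarith [hβ.monotone this]
      have hpos : ∀ i, c i ≠ 0 → 0 < c i ^ 2 * (β i - a k) * dotp (z i) (z i) := fun i hi =>
        mul_pos (mul_pos (by positivity) (hb i hi)) (npos i)
      refine Finset.sum_pos' (fun i _ => ?_) ⟨i, Finset.mem_univ i, hpos i hi⟩
      by_cases h : c i = 0
      · rw [h]; simp
      · exact (hpos i h).le
    have := sq_nonneg (dotp (fun q => ∑ i, c i * z i q) x)
    linarith

/-- a common tangent line to the `d−1` confocal quadrics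
`Q_{α₁}, …, Q_{α_{d−1}}` exists iff, in the increasing rearrangement `b₁ < … < b_{2d−1}` of
`a₁,…,a_d,α₁,…,α_{d−1}`, the increasingly ordered `α`'s satisfy `α_{(j)} ∈ {b_{2j−1}, b_{2j}}`
for all `j`. -/
theorem existence_of_common_tangent_line {d : ℕ} (hd : 2 ≤ d)
    (a : Fin d → ℝ) (ha : StrictMono a)
    (α : Fin (d - 1) → ℝ) (hαinj : Function.Injective α) (hαa : ∀ j k, α j ≠ a k)
    (b : Fin (2 * d - 1) → ℝ) (hb : StrictMono b)
    (hbr : Set.range b = Set.range a ∪ Set.range α)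
    (β : Fin (d - 1) → ℝ) (hβ : StrictMono β) (hβr : Set.range β = Set.range α) :
    (∃ x y : Fin d → ℝ, y ≠ 0 ∧ ∀ j, Phi a (α j) x y = 0) ↔
      (∀ j : Fin (d - 1), β j = b ⟨2 * (j : ℕ), by have := j.isLt; omega⟩ ∨
        β j = b ⟨2 * (j : ℕ) + 1, by have := j.isLt; omega⟩) := by
  obtain ⟨n, rfl⟩ : ∃ n, d = n + 1 := ⟨d - 1, by omega⟩
  have hβa : ∀ j k, β j ≠ a k := by
    intro j k
    obtain ⟨i, hi⟩ : β j ∈ Set.range α := hβr ▸ ⟨j, rfl⟩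
    rw [← hi]
    exact hαa i k
  have hPhi : ∀ x y : Fin (n + 1) → ℝ, (∀ j, Phi a (α j) x y = 0) ↔
      ∀ j, Phi a (β j) x y = 0 := by
    intro x y
    have h1 := Set.forall_mem_range (f := α) (p := fun v => Phi a v x y = 0)
    have h2 := Set.forall_mem_range (f := β) (p := fun v => Phi a v x y = 0)
    rw [← h1, ← h2, hβr]
  rw [← hβr] at hbr
  have hcomb := fun j => comb a ha β hβ rfl hβa b hb hbr j (by have := j.isLt; omega)
    (by have := j.isLt; omega)
  constructor
  · rintro ⟨x, y, hy, h⟩ j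
    exact (hcomb j).2 (nec a ha β hβ hβa x y hy ((hPhi x y).1 h) j)
  · intro h
    obtain ⟨x, y, hy, hxy⟩ := suff (by omega) a ha β hβ hβa
      (fun j => ((hcomb j).1 (h j)).1) (fun j => ((hcomb j).1 (h j)).2)
    exact ⟨x, y, hy, (hPhi x y).2 hxy⟩
end
end
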